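/- Let F be a finite field of characteristic different from 2 with a nonidentity involution a ↦ ā, and let F∘ be the fixed field of the involution. Each pair of Hermitian matrices of the same size over F is *congruent to a direct sum, uniquely determined up to permutation of summands, of pairs of the following types: (i) ([F_n ⟍ F_n*], [G_n ⟍ G_n*]); (ii) ([I_n ⟍ I_n], [Φ ⟍ Φ*]), where Φ is an n×n Frobenius block over F such that p_Φ(x) ∉ F∘[x], and Φ is determined up to replacement by the Frobenius block Ψ with χ_Ψ(x) = χ̄_Φ(x) (coefficientwise conjugation); (iii) (Φ₁, Φ₁Φ), where Φ is a Frobenius block over F∘; (iv) B_n for n = 1,2,…. -/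

import Mathlib

open Polynomial Matrix

namespace Can

noncomputable section

abbrev Mat (F : Type*) (n : ℕ) := Matrix (Fin n) (Fin n) F

variable {F : Type*} [Field F]

/-- conjugate transpose w.r.t. an involution σ -/
def ctr (σ : F →+* F) {m n : ℕ} (A : Matrix (Fin m) (Fin n) F) : Matrix (Fin n) (Fin m) F :=
  (A.map σ)ᵀ

/-- congruence: SᵀAS = B for a nonsingular S -/
def Congruent {n : ℕ} (A B : Mat F n) : Prop :=
  ∃ S : Mat F n, IsUnit S.det ∧ Sᵀ * A * S = B

/-- *congruence: S*AS = B for a nonsingular S -/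
def StarCongruent (σ : F →+* F) {n : ℕ} (A B : Mat F n) : Prop :=
  ∃ S : Mat F n, IsUnit S.det ∧ ctr σ S * A * S = B

/-- a square-matrix "summand" of unspecified size -/
abbrev Block (F : Type*) := Σ n : ℕ, Mat F n

def castMat {m n : ℕ} (h : m = n) (A : Mat F m) : Mat F n :=
  Matrix.reindex (finCongr h) (finCongr h) A

def BCong (X Y : Block F) : Prop :=
  ∃ h : X.1 = Y.1, Congruent (castMat h X.2) Y.2

def BStarCong (σ : F →+* F) (X Y : Block F) : Prop :=
  ∃ h : X.1 = Y.1, StarCongruent σ (castMat h X.2) Y.2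

/-- direct sum of a list of blocks -/
def bsum : List (Block F) → Block F
  | [] => ⟨0, 0⟩
  | X :: L => ⟨X.1 + (bsum L).1,
      Matrix.reindex finSumFinEquiv finSumFinEquiv (Matrix.fromBlocks X.2 0 0 (bsum L).2)⟩

/-- pairs of square matrices of the same size -/
abbrev PBlock (F : Type*) := Σ n : ℕ, Mat F n × Mat F n

def PCong (X Y : PBlock F) : Prop :=
  ∃ h : X.1 = Y.1, ∃ S : Mat F Y.1, IsUnit S.det ∧
    Sᵀ * castMat h X.2.1 * S = Y.2.1 ∧ Sᵀ * castMat h X.2.2 * S = Y.2.2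

def PStarCong (σ : F →+* F) (X Y : PBlock F) : Prop :=
  ∃ h : X.1 = Y.1, ∃ S : Mat F Y.1, IsUnit S.det ∧
    ctr σ S * castMat h X.2.1 * S = Y.2.1 ∧ ctr σ S * castMat h X.2.2 * S = Y.2.2

def psum : List (PBlock F) → PBlock F
  | [] => ⟨0, (0, 0)⟩
  | X :: L =>
      ⟨X.1 + (psum L).1,
        (Matrix.reindex finSumFinEquiv finSumFinEquiv (Matrix.fromBlocks X.2.1 0 0 (psum L).2.1),
         Matrix.reindex finSumFinEquiv finSumFinEquiv (Matrix.fromBlocks X.2.2 0 0 (psum L).2.2))⟩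

/-- lower-triangular Jordan block -/
def J (F : Type*) [Field F] (n : ℕ) (lam : F) : Mat F n :=
  Matrix.of fun i j => if i = j then lam else if (i : ℕ) = (j : ℕ) + 1 then 1 else 0

/-- the companion (Frobenius) matrix of a polynomial -/
def companion (F : Type*) [Field F] (f : Polynomial F) : Mat F f.natDegree :=
  Matrix.of fun i j => if (i : ℕ) = (j : ℕ) + 1 then 1
    else if (j : ℕ) + 1 = f.natDegree then -f.coeff i else 0

/-- f ↦ f^∨ (with respect to the involution σ) -/
def dualPoly (σ : F →+* F) (f : Polynomial F) : Polynomial F :=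
  Polynomial.C (σ (f.coeff 0))⁻¹ * (f.map σ).reverse

/-- the skew sum [A ⟍ B] = [[0, B], [A, 0]] -/
def skewSum {k l : ℕ} (A : Matrix (Fin k) (Fin l) F) (B : Matrix (Fin l) (Fin k) F) :
    Mat F (l + k) :=
  Matrix.reindex finSumFinEquiv finSumFinEquiv (Matrix.fromBlocks 0 B A 0)

/-- the matrix Γₙ -/
def Gamma (F : Type*) [Field F] (n : ℕ) : Mat F n :=
  Matrix.of fun i j =>
    if (i : ℕ) + (j : ℕ) + 1 = n ∨ (i : ℕ) + (j : ℕ) = n then (-1 : F) ^ (n - 1 - (i : ℕ)) else 0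

/-- Fₙ = [I | 0], an (n−1)×n matrix -/
def Fmat (F : Type*) [Field F] (n : ℕ) : Matrix (Fin (n - 1)) (Fin n) F :=
  Matrix.of fun i j => if (i : ℕ) = (j : ℕ) then 1 else 0

/-- Gₙ = [0 | I], an (n−1)×n matrix -/
def Gmat (F : Type*) [Field F] (n : ℕ) : Matrix (Fin (n - 1)) (Fin n) F :=
  Matrix.of fun i j => if (i : ℕ) + 1 = (j : ℕ) then 1 else 0

/-- the pair Bₙ of symmetric n×n matrices -/
def Bpair (F : Type*) [Field F] (n : ℕ) : Mat F n × Mat F n :=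
  (Matrix.of fun i j => if (i : ℕ) + (j : ℕ) + 2 = n then 1 else 0,
   Matrix.of fun i j => if (i : ℕ) + (j : ℕ) + 1 = n then 1 else 0)

/-- the pair Cₙ of a symmetric and a skew-symmetric n×n matrix -/
def Cpair (F : Type*) [Field F] (n : ℕ) : Mat F n × Mat F n :=
  if Odd n then
    (Matrix.of fun i j => if (i : ℕ) + (j : ℕ) + 1 = n then 1 else 0,
     Matrix.of fun i j =>
       if (i : ℕ) + (j : ℕ) + 2 = n ∧ i < j then 1
       else if (i : ℕ) + (j : ℕ) + 2 = n ∧ j < i then -1 else 0)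
  else
    (Matrix.of fun i j => if (i : ℕ) + (j : ℕ) + 2 = n then 1 else 0,
     Matrix.of fun i j =>
       if (i : ℕ) + (j : ℕ) + 1 = n ∧ i < j then 1
       else if (i : ℕ) + (j : ℕ) + 1 = n ∧ j < i then -1 else 0)

/-- at most one entry of the list satisfies P -/
def AtMostOne {α : Type*} (P : α → Prop) (L : List α) : Prop :=
  ¬ ∃ b₁ b₂ : α, List.Sublist [b₁, b₂] L ∧ P b₁ ∧ P b₂


section Stmt4
variable {F : Type*} [Field F] (σ : F →+* F)

/-- the pair ([Iₙ ⟍ Iₙ], [Φ ⟍ Φ*]) attached to the characteristic polynomial χ of Φ -/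
def pairStar4 (χ : Polynomial F) : PBlock F :=
  ⟨χ.natDegree + χ.natDegree,
    (skewSum (1 : Mat F χ.natDegree) (1 : Mat F χ.natDegree),
     skewSum (companion F χ) (ctr σ (companion F χ)))⟩

/-- type (i): ([Fₙ ⟍ Fₙ*], [Gₙ ⟍ Gₙ*]) -/
def T4i (b : PBlock F) : Prop :=
  ∃ n : ℕ, 0 < n ∧
    b = ⟨n + (n - 1), (skewSum (Fmat F n) (ctr σ (Fmat F n)),
                       skewSum (Gmat F n) (ctr σ (Gmat F n)))⟩

/-- type (ii): ([Iₙ ⟍ Iₙ], [Φ ⟍ Φ*]), p_Φ ∉ F∘[x] -/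
def T4ii (b : PBlock F) : Prop :=
  ∃ (pp : Polynomial F) (l : ℕ), pp.Monic ∧ Irreducible pp ∧ 0 < l ∧
    (¬ ∀ k : ℕ, σ (pp.coeff k) = pp.coeff k) ∧
    b = pairStar4 σ (pp ^ l)

/-- type (iii): (Φ₁, Φ₁Φ), Φ a Frobenius block over the fixed field F∘ -/
def T4iii (Phi1 : (q : Polynomial F) → Mat F q.natDegree) (b : PBlock F) : Prop :=
  ∃ (pp : Polynomial F) (l : ℕ), pp.Monic ∧ Irreducible pp ∧ 0 < l ∧
    (∀ k : ℕ, σ (pp.coeff k) = pp.coeff k) ∧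
    b = ⟨(pp ^ l).natDegree, (Phi1 (pp ^ l), Phi1 (pp ^ l) * companion F (pp ^ l))⟩

/-- type (iv): Bₙ -/
def T4iv (b : PBlock F) : Prop := ∃ n : ℕ, 0 < n ∧ b = ⟨n, Bpair F n⟩

/-- a type (ii) summand may be replaced by the one with χ_Ψ = χ̄_Φ -/
def Equiv4 (b c : PBlock F) : Prop :=
  b = c ∨
  ∃ (pp : Polynomial F) (l : ℕ), pp.Monic ∧ Irreducible pp ∧ 0 < l ∧
    (¬ ∀ k : ℕ, σ (pp.coeff k) = pp.coeff k) ∧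
    b = pairStar4 σ (pp ^ l) ∧ c = pairStar4 σ ((pp ^ l).map σ)

section KrullSchmidt
open CategoryTheory CategoryTheory.Limits

theorem exists_isIdempotentElem_pow {M : Type*} [Monoid M] [Finite M] (x : M) :
    ∃ n, 0 < n ∧ IsIdempotentElem (x ^ n) := by
  obtain ⟨a, b, hab, h⟩ : ∃ a b : ℕ, a < b ∧ x ^ a = x ^ b := by
    obtain ⟨a, b, hne, h⟩ := Finite.exists_ne_map_eq_of_infinite fun n : ℕ => x ^ n
    rcases lt_or_gt_of_ne hne with hl | hl
    · exact ⟨a, b, hl, h⟩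
    · exact ⟨b, a, hl, h.symm⟩
  obtain ⟨d, rfl⟩ := Nat.exists_eq_add_of_lt hab
  have step : ∀ n, a ≤ n → x ^ (n + (d + 1)) = x ^ n := by
    intro n hn
    obtain ⟨c, rfl⟩ := Nat.exists_eq_add_of_le hn
    rw [show a + c + (d + 1) = (a + d + 1) + c by ring, pow_add, ← h, ← pow_add]
  have steps : ∀ k n, a ≤ n → x ^ (n + k * (d + 1)) = x ^ n := by
    intro k
    induction k with
    | zero => simp
    | succ k ih =>
      intro n hn
      rw [show n + (k + 1) * (d + 1) = n + k * (d + 1) + (d + 1) by ring, step _ (by omega), ih n hn]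
  refine ⟨(a + 1) * (d + 1), by positivity, ?_⟩
  rw [IsIdempotentElem, ← pow_add]
  exact steps (a + 1) _ (by nlinarith)

universe v w
variable {C : Type w} [Category.{v} C] [Preadditive C]

/-- A nonzero object without nontrivial idempotent endomorphisms. -/
structure IsIndec (X : C) : Prop where
  ne_zero : 𝟙 X ≠ 0
  idem : ∀ e : X ⟶ X, e ≫ e = e → e = 0 ∨ e = 𝟙 X

theorem IsIndec.isIso_or_pow_eq_zero {X : C} (hX : IsIndec X) [Finite (X ⟶ X)] (f : End X) :
    IsIso f ∨ ∃ n, f ^ n = 0 := by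
  have : Finite (End X) := ‹Finite (X ⟶ X)›
  obtain ⟨n, hn, hf⟩ := exists_isIdempotentElem_pow f
  rcases hX.idem (f ^ n) hf with h | h
  · exact Or.inr ⟨n, h⟩
  · left
    have : IsUnit (f ^ n) := by
      have h' : f ^ n = 1 := h
      rw [h']; exact isUnit_one
    exact (isUnit_iff_isIso f).1 ((isUnit_pow_iff hn.ne').1 this)

theorem IsIndec.isIso_or_isIso_of_add {X : C} (hX : IsIndec X) [Finite (X ⟶ X)] (f g : End X)
    (h : f + g = 𝟙 X) : IsIso f ∨ IsIso g := by
  rcases hX.isIso_or_pow_eq_zero f with hf | ⟨n, hn⟩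
  · exact Or.inl hf
  · right
    have hu : IsUnit ((1 : End X) - f) := IsNilpotent.isUnit_one_sub ⟨n, hn⟩
    have hg : (1 : End X) - (f : End X) = g := sub_eq_of_eq_add' h.symm
    rw [hg] at hu
    exact (isUnit_iff_isIso _).1 hu

theorem IsIndec.isIso_of_isIso_comp {X Y : C} (hX : IsIndec X) (hY : IsIndec Y) (f : X ⟶ Y)
    (g : Y ⟶ X) [IsIso (f ≫ g)] : IsIso f := by
  have h1 : f ≫ g ≫ inv (f ≫ g) = 𝟙 X := by rw [← Category.assoc, IsIso.hom_inv_id]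
  rcases hY.idem ((g ≫ inv (f ≫ g)) ≫ f) (by
    simp only [Category.assoc] at h1 ⊢
    rw [reassoc_of% h1]) with h | h
  · exfalso
    apply hX.ne_zero
    rw [← h1, ← Category.comp_id (f ≫ g ≫ inv (f ≫ g)), ← h1]
    have := congrArg (fun t => f ≫ t ≫ g ≫ inv (f ≫ g)) h
    simpa using this
  · exact ⟨⟨_, h1, h⟩⟩

variable [HasBinaryBiproducts C]

theorem exists_biprod_iso_of_retract [IsIdempotentComplete C] {X M : C} (f : X ⟶ M) (g : M ⟶ X)
    (h : f ≫ g = 𝟙 X) : ∃ (N : C) (e : M ≅ X ⊞ N), f ≫ e.hom = biprod.inl ∧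
      e.hom ≫ biprod.fst = g := by
  obtain ⟨N, i, p, hip, hpi⟩ := IsIdempotentComplete.idempotents_split M (𝟙 M - g ≫ f) (by
    simp [reassoc_of% h])
  have hig : i ≫ g = 0 := by
    have : p ≫ i ≫ g = 0 := by
      rw [reassoc_of% hpi]; simp [h]
    rw [← Category.id_comp (i ≫ g), ← hip, Category.assoc, this, Limits.comp_zero]
  have hfp : f ≫ p = 0 := by
    have : (f ≫ p) ≫ i = 0 := by
      rw [Category.assoc, hpi]; simp [reassoc_of% h]
    rw [← Category.comp_id (f ≫ p), ← hip, ← Category.assoc, this, Limits.zero_comp]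
  refine ⟨N, ⟨biprod.lift g p, biprod.desc f i, ?_, ?_⟩, ?_, ?_⟩
  · simp [biprod.lift_desc, hpi]
  · ext <;> simp [h, hip, hig, hfp]
  · ext <;> simp [h, hfp]
  · simp

theorem IsIndec.not_isZero {X P Z : C} (hX : IsIndec X) (φ : X ⊞ P ≅ Z) : ¬ IsZero Z := by
  intro hZ
  apply hX.ne_zero
  have : biprod.inl ≫ φ.hom ≫ φ.inv ≫ biprod.fst = 𝟙 X := by simp
  rw [← this, hZ.eq_of_tgt φ.hom 0]
  simp

theorem IsIndec.exchange [IsIdempotentComplete C] {X P Y Q : C} [Finite (X ⟶ X)]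
    (hX : IsIndec X) (hY : IsIndec Y) (φ : X ⊞ P ≅ Y ⊞ Q) :
    (Nonempty (X ≅ Y) ∧ Nonempty (P ≅ Q)) ∨
      ∃ N, Nonempty (X ⊞ N ≅ Q) ∧ Nonempty (P ≅ Y ⊞ N) := by
  have hsum : (biprod.inl ≫ φ.hom ≫ biprod.fst) ≫ (biprod.inl ≫ φ.inv ≫ biprod.fst) +
      (biprod.inl ≫ φ.hom ≫ biprod.snd) ≫ (biprod.inr ≫ φ.inv ≫ biprod.fst) = 𝟙 X := by
    calc _ = biprod.inl ≫ φ.hom ≫ (biprod.fst ≫ biprod.inl + biprod.snd ≫ biprod.inr) ≫ φ.inv ≫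
          biprod.fst := by
            simp only [Preadditive.add_comp, Preadditive.comp_add, Category.assoc]
      _ = _ := by simp [biprod.total]
  rcases hX.isIso_or_isIso_of_add _ _ hsum with h | h
  · have := hX.isIso_of_isIso_comp hY (biprod.inl ≫ φ.hom ≫ biprod.fst)
      (biprod.inl ≫ φ.inv ≫ biprod.fst)
    exact Or.inl ⟨⟨asIso (biprod.inl ≫ φ.hom ≫ biprod.fst)⟩, ⟨Biprod.isoElim φ⟩⟩
  · right
    set f := biprod.inl ≫ φ.hom ≫ biprod.snd with hf
    set g := biprod.inr ≫ φ.inv ≫ biprod.fst with hg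
    obtain ⟨N, e, he, -⟩ := exists_biprod_iso_of_retract f (g ≫ inv (f ≫ g))
      (by rw [← Category.assoc, IsIso.hom_inv_id])
    let ψ : X ⊞ P ≅ X ⊞ (Y ⊞ N) := φ ≪≫ biprod.mapIso (Iso.refl _) e ≪≫
      (biprod.associator _ _ _).symm ≪≫ biprod.mapIso (biprod.braiding _ _) (Iso.refl _) ≪≫
      biprod.associator _ _ _
    have hψ : biprod.inl ≫ ψ.hom ≫ biprod.fst = f ≫ e.hom ≫ biprod.fst := by
      simp [ψ, hf]
    have : IsIso (biprod.inl ≫ ψ.hom ≫ biprod.fst) := by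
      rw [hψ, ← Category.assoc, he, biprod.inl_fst]
      infer_instance
    exact ⟨N, ⟨e.symm⟩, ⟨Biprod.isoElim ψ⟩⟩

variable [HasZeroObject C] {ι : Type*} (K : ι → C)

open scoped ZeroObject in
/-- The direct sum of the objects `K i`, `i` in a list. -/
def listSum : List ι → C
  | [] => 0
  | i :: l => K i ⊞ listSum l

theorem listSum_perm {l l' : List ι} (h : l.Perm l') :
    Nonempty (listSum K l ≅ listSum K l') := by
  induction h with
  | nil => exact ⟨Iso.refl _⟩
  | cons i _ ih => exact ⟨biprod.mapIso (Iso.refl _) ih.some⟩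
  | swap i j l =>
    exact ⟨(biprod.associator (K j) (K i) (listSum K l)).symm ≪≫
      biprod.mapIso (biprod.braiding _ _) (Iso.refl _) ≪≫ biprod.associator _ _ _⟩
  | trans _ _ h1 h2 => exact ⟨h1.some ≪≫ h2.some⟩

theorem isZero_listSum_nil : IsZero (listSum K []) := isZero_zero C

theorem listSum_append (l l' : List ι) :
    Nonempty (listSum K (l ++ l') ≅ listSum K l ⊞ listSum K l') := by
  induction l with
  | nil =>
    refine ⟨⟨biprod.inr, biprod.snd, biprod.inr_snd, ?_⟩⟩
    ext
    · exact (isZero_listSum_nil K).eq_of_src _ _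
    · exact (isZero_listSum_nil K).eq_of_src _ _
    · exact (isZero_listSum_nil K).eq_of_tgt _ _
    · simp
  | cons i l ih =>
    exact ⟨biprod.mapIso (Iso.refl _) ih.some ≪≫ (biprod.associator _ _ _).symm⟩

variable [IsIdempotentComplete C] [∀ X Y : C, Finite (X ⟶ Y)]

theorem exists_perm_cons_of_iso (hK : ∀ i, IsIndec (K i)) {X : C} (hX : IsIndec X) (l : List ι) (P : C)
    (φ : X ⊞ P ≅ listSum K l) :
    ∃ i l', l.Perm (i :: l') ∧ Nonempty (X ≅ K i) ∧ Nonempty (P ≅ listSum K l') := by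
  induction l generalizing P with
  | nil => exact (hX.not_isZero φ (isZero_listSum_nil K)).elim
  | cons j t ih =>
    rcases hX.exchange (Q := listSum K t) (hK j) φ with ⟨h1, h2⟩ | ⟨N, ⟨e⟩, ⟨e'⟩⟩
    · exact ⟨j, t, List.Perm.refl _, h1, h2⟩
    · obtain ⟨i, l', hp, hXi, ⟨eN⟩⟩ := ih N e
      exact ⟨i, j :: l', (hp.cons j).trans (List.Perm.swap _ _ _), hXi,
        ⟨e' ≪≫ biprod.mapIso (Iso.refl _) eN⟩⟩

/-- The Krull–Schmidt theorem. -/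
theorem perm_of_listSum_iso (hK : ∀ i, IsIndec (K i))
    (hinj : ∀ i j, Nonempty (K i ≅ K j) → i = j) (l l' : List ι)
    (φ : listSum K l ≅ listSum K l') : l.Perm l' := by
  induction l generalizing l' with
  | nil =>
    cases l' with
    | nil => exact List.Perm.refl _
    | cons j t =>
      exact ((hK j).not_isZero (P := listSum K t) φ.symm (isZero_listSum_nil K)).elim
  | cons i l ih =>
    obtain ⟨j, t, hp, hij, ⟨e⟩⟩ := exists_perm_cons_of_iso K hK (hK i) l' _ φ
    obtain rfl := hinj i j hij
    exact ((ih t e).cons i).trans hp.symm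

end KrullSchmidt

section PencilCategory
open CategoryTheory CategoryTheory.Limits
universe u

/-- A pencil: a pair of matrices of the same shape. -/
structure Pencil (F : Type u) where
  Row : Type
  Col : Type
  [fintypeRow : Fintype Row]
  [fintypeCol : Fintype Col]
  [decEqRow : DecidableEq Row]
  [decEqCol : DecidableEq Col]
  A : Matrix Row Col F
  B : Matrix Row Col F

namespace Pencil

attribute [instance] fintypeRow fintypeCol decEqRow decEqCol

variable {F : Type u} [Field F]

/-- A morphism of pencils: a pair of matrices intertwining both matrices of the pencils. -/
@[ext]
structure Hom (X Y : Pencil F) where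
  P : Matrix Y.Row X.Row F
  Q : Matrix Y.Col X.Col F
  hA : P * X.A = Y.A * Q
  hB : P * X.B = Y.B * Q

instance : Category (Pencil F) where
  Hom := Hom
  id X := ⟨1, 1, by simp, by simp⟩
  comp {X Y Z} f g := ⟨g.P * f.P, g.Q * f.Q,
    by rw [Matrix.mul_assoc, f.hA, ← Matrix.mul_assoc, g.hA, Matrix.mul_assoc],
    by rw [Matrix.mul_assoc, f.hB, ← Matrix.mul_assoc, g.hB, Matrix.mul_assoc]⟩
  id_comp f := Hom.ext (Matrix.mul_one _) (Matrix.mul_one _)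
  comp_id f := Hom.ext (Matrix.one_mul _) (Matrix.one_mul _)
  assoc f g h := Hom.ext (Matrix.mul_assoc _ _ _).symm (Matrix.mul_assoc _ _ _).symm

@[ext]
theorem hom_ext {X Y : Pencil F} {f g : X ⟶ Y} (hP : f.P = g.P) (hQ : f.Q = g.Q) : f = g :=
  Hom.ext hP hQ

@[simp] theorem id_P (X : Pencil F) : Hom.P (𝟙 X) = 1 := rfl
@[simp] theorem id_Q (X : Pencil F) : Hom.Q (𝟙 X) = 1 := rfl
@[simp] theorem comp_P {X Y Z : Pencil F} (f : X ⟶ Y) (g : Y ⟶ Z) : (f ≫ g).P = g.P * f.P := rfl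
@[simp] theorem comp_Q {X Y Z : Pencil F} (f : X ⟶ Y) (g : Y ⟶ Z) : (f ≫ g).Q = g.Q * f.Q := rfl

section
variable {X Y : Pencil F}

instance : Zero (X ⟶ Y) := ⟨⟨0, 0, by simp, by simp⟩⟩
instance : Add (X ⟶ Y) := ⟨fun f g => ⟨f.P + g.P, f.Q + g.Q,
  by rw [Matrix.add_mul, Matrix.mul_add, f.hA, g.hA],
  by rw [Matrix.add_mul, Matrix.mul_add, f.hB, g.hB]⟩⟩
instance : Neg (X ⟶ Y) := ⟨fun f => ⟨-f.P, -f.Q,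
  by rw [Matrix.neg_mul, Matrix.mul_neg, f.hA],
  by rw [Matrix.neg_mul, Matrix.mul_neg, f.hB]⟩⟩

@[simp] theorem add_P (f g : X ⟶ Y) : (f + g).P = f.P + g.P := rfl
@[simp] theorem add_Q (f g : X ⟶ Y) : (f + g).Q = f.Q + g.Q := rfl

instance : AddCommGroup (X ⟶ Y) where
  add_assoc _ _ _ := hom_ext (add_assoc _ _ _) (add_assoc _ _ _)
  zero_add _ := hom_ext (zero_add _) (zero_add _)
  add_zero _ := hom_ext (add_zero _) (add_zero _)
  neg_add_cancel _ := hom_ext (neg_add_cancel _) (neg_add_cancel _)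
  add_comm _ _ := hom_ext (add_comm _ _) (add_comm _ _)
  nsmul := nsmulRec
  zsmul := zsmulRec

instance [Finite F] : Finite (X ⟶ Y) :=
  Finite.of_injective (fun f : X ⟶ Y => (f.P, f.Q)) fun f g h => by
    simp only [Prod.mk.injEq] at h
    exact hom_ext h.1 h.2

end

instance : Preadditive (Pencil F) where
  homGroup _ _ := inferInstance
  add_comp _ _ _ f g h := by
    refine hom_ext ?_ ?_
    · rw [comp_P, add_P, add_P, comp_P, comp_P, Matrix.mul_add]
    · rw [comp_Q, add_Q, add_Q, comp_Q, comp_Q, Matrix.mul_add]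
  comp_add _ _ _ f g h := by
    refine hom_ext ?_ ?_
    · rw [comp_P, add_P, add_P, comp_P, comp_P, Matrix.add_mul]
    · rw [comp_Q, add_Q, add_Q, comp_Q, comp_Q, Matrix.add_mul]

theorem isZero_of_isEmpty (X : Pencil F) [IsEmpty X.Row] [IsEmpty X.Col] : IsZero X :=
  (IsZero.iff_id_eq_zero X).2 (hom_ext (Subsingleton.elim _ _) (Subsingleton.elim _ _))

instance : HasZeroObject (Pencil F) :=
  ⟨⟨Empty, Empty, 0, 0⟩, @isZero_of_isEmpty _ _ ⟨Empty, Empty, 0, 0⟩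
    (inferInstanceAs (IsEmpty Empty)) (inferInstanceAs (IsEmpty Empty))⟩

/-- The direct sum of two pencils. -/
def sum (X Y : Pencil F) : Pencil F :=
  ⟨X.Row ⊕ Y.Row, X.Col ⊕ Y.Col, fromBlocks X.A 0 0 Y.A, fromBlocks X.B 0 0 Y.B⟩

section
variable {I I' J J' : Type}

theorem fromCols_one_zero_mul [Fintype I] [Fintype I'] [Fintype J] [DecidableEq I] [DecidableEq J]
    (M : Matrix I J F) (N : Matrix I' J' F) :
    fromCols (1 : Matrix I I F) (0 : Matrix I I' F) * fromBlocks M 0 0 N =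
      M * fromCols (1 : Matrix J J F) (0 : Matrix J J' F) := by
  rw [fromCols_mul_fromBlocks, mul_fromCols]
  simp

theorem fromCols_zero_one_mul [Fintype I] [Fintype I'] [Fintype J'] [DecidableEq I'] [DecidableEq J']
    (M : Matrix I J F) (N : Matrix I' J' F) :
    fromCols (0 : Matrix I' I F) (1 : Matrix I' I' F) * fromBlocks M 0 0 N =
      N * fromCols (0 : Matrix J' J F) (1 : Matrix J' J' F) := by
  rw [fromCols_mul_fromBlocks, mul_fromCols]
  simp

theorem fromRows_one_zero_mul [Fintype I] [Fintype J] [Fintype J'] [DecidableEq I] [DecidableEq J]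
    (M : Matrix I J F) (N : Matrix I' J' F) :
    fromRows (1 : Matrix I I F) (0 : Matrix I' I F) * M =
      fromBlocks M 0 0 N * fromRows (1 : Matrix J J F) (0 : Matrix J' J F) := by
  rw [fromBlocks_mul_fromRows, fromRows_mul]
  simp

theorem fromRows_zero_one_mul [Fintype I'] [Fintype J] [Fintype J'] [DecidableEq I'] [DecidableEq J']
    (M : Matrix I J F) (N : Matrix I' J' F) :
    fromRows (0 : Matrix I I' F) (1 : Matrix I' I' F) * N =
      fromBlocks M 0 0 N * fromRows (0 : Matrix J J' F) (1 : Matrix J' J' F) := by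
  rw [fromBlocks_mul_fromRows, fromRows_mul]
  simp

theorem fromCols_mul_fromRows_one_zero [Fintype I] [Fintype I'] [DecidableEq I] :
    fromCols (1 : Matrix I I F) (0 : Matrix I I' F) *
      fromRows (1 : Matrix I I F) (0 : Matrix I' I F) = 1 := by
  rw [fromCols_mul_fromRows]
  simp

theorem fromCols_mul_fromRows_zero_one [Fintype I] [Fintype I'] [DecidableEq I'] :
    fromCols (0 : Matrix I' I F) (1 : Matrix I' I' F) *
      fromRows (0 : Matrix I I' F) (1 : Matrix I' I' F) = 1 := by
  rw [fromCols_mul_fromRows]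
  simp

theorem fromCols_one_zero_mul_fromRows [Fintype I] [Fintype I'] [DecidableEq I] [DecidableEq I'] :
    fromCols (1 : Matrix I I F) (0 : Matrix I I' F) *
      fromRows (0 : Matrix I I' F) (1 : Matrix I' I' F) = 0 := by
  rw [fromCols_mul_fromRows]
  simp

theorem fromCols_zero_one_mul_fromRows [Fintype I] [Fintype I'] [DecidableEq I] [DecidableEq I'] :
    fromCols (0 : Matrix I' I F) (1 : Matrix I' I' F) *
      fromRows (1 : Matrix I I F) (0 : Matrix I' I F) = 0 := by
  rw [fromCols_mul_fromRows]
  simp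

theorem fromRows_mul_fromCols_add [Fintype I] [Fintype I'] [DecidableEq I] [DecidableEq I'] :
    fromRows (1 : Matrix I I F) (0 : Matrix I' I F) *
        fromCols (1 : Matrix I I F) (0 : Matrix I I' F) +
      fromRows (0 : Matrix I I' F) (1 : Matrix I' I' F) *
        fromCols (0 : Matrix I' I F) (1 : Matrix I' I' F) = 1 := by
  rw [fromRows_mul_fromCols, fromRows_mul_fromCols, fromBlocks_add]
  simp

end

/-- The direct sum of pencils as a bicone. -/
def sumBicone (X Y : Pencil F) : BinaryBicone X Y where
  pt := X.sum Y
  fst := ⟨fromCols 1 0, fromCols 1 0, fromCols_one_zero_mul _ _, fromCols_one_zero_mul _ _⟩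
  snd := ⟨fromCols 0 1, fromCols 0 1, fromCols_zero_one_mul _ _, fromCols_zero_one_mul _ _⟩
  inl := ⟨fromRows 1 0, fromRows 1 0, fromRows_one_zero_mul _ _, fromRows_one_zero_mul _ _⟩
  inr := ⟨fromRows 0 1, fromRows 0 1, fromRows_zero_one_mul _ _, fromRows_zero_one_mul _ _⟩
  inl_fst := hom_ext fromCols_mul_fromRows_one_zero fromCols_mul_fromRows_one_zero
  inl_snd := hom_ext fromCols_zero_one_mul_fromRows fromCols_zero_one_mul_fromRows
  inr_fst := hom_ext fromCols_one_zero_mul_fromRows fromCols_one_zero_mul_fromRows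
  inr_snd := hom_ext fromCols_mul_fromRows_zero_one fromCols_mul_fromRows_zero_one

theorem sumBicone_total (X Y : Pencil F) :
    (sumBicone X Y).fst ≫ (sumBicone X Y).inl + (sumBicone X Y).snd ≫ (sumBicone X Y).inr =
      𝟙 (sumBicone X Y).pt :=
  hom_ext fromRows_mul_fromCols_add fromRows_mul_fromCols_add

instance : HasBinaryBiproducts (Pencil F) :=
  ⟨fun X Y => hasBinaryBiproduct_of_total (sumBicone X Y) (sumBicone_total X Y)⟩

theorem sum_iso_biprod (X Y : Pencil F) : Nonempty (X.sum Y ≅ X ⊞ Y) :=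
  ⟨biprod.uniqueUpToIso X Y (isBinaryBilimitOfTotal (sumBicone X Y) (sumBicone_total X Y))⟩

theorem exists_splitting_of_isIdempotentElem {J : Type} [Fintype J] [DecidableEq J]
    (E : Matrix J J F) (hE : E * E = E) :
    ∃ (k : ℕ) (i : Matrix J (Fin k) F) (p : Matrix (Fin k) J F), p * i = 1 ∧ i * p = E := by
  let T := toLin' E
  have hT : ∀ x, T (T x) = T x := fun x => by
    simp only [T, ← LinearMap.comp_apply, ← toLin'_mul, hE]
  let b := Module.finBasis F (LinearMap.range T)
  let i : (Fin (Module.finrank F (LinearMap.range T)) → F) →ₗ[F] (J → F) :=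
    (LinearMap.range T).subtype ∘ₗ b.equivFun.symm.toLinearMap
  let p : (J → F) →ₗ[F] (Fin (Module.finrank F (LinearMap.range T)) → F) :=
    b.equivFun.toLinearMap ∘ₗ T.rangeRestrict
  refine ⟨_, LinearMap.toMatrix' i, LinearMap.toMatrix' p, ?_, ?_⟩
  · rw [← LinearMap.toMatrix'_comp, ← LinearMap.toMatrix'_id]
    congr 1
    refine LinearMap.ext fun x => ?_
    obtain ⟨y, hy⟩ := (b.equivFun.symm x).2
    have : T.rangeRestrict (b.equivFun.symm x : J → F) = b.equivFun.symm x := by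
      apply Subtype.ext
      change T _ = _
      rw [← hy, hT]
    change b.equivFun (T.rangeRestrict (b.equivFun.symm x : J → F)) = x
    rw [this, LinearEquiv.apply_symm_apply]
  · rw [← LinearMap.toMatrix'_comp]
    have : i ∘ₗ p = T := by
      refine LinearMap.ext fun x => ?_
      change ((b.equivFun.symm (b.equivFun (T.rangeRestrict x)) : LinearMap.range T) : J → F) = T x
      rw [LinearEquiv.symm_apply_apply]
      rfl
    rw [this]
    exact LinearMap.toMatrix'_toLin' E

instance : IsIdempotentComplete (Pencil F) where
  idempotents_split X e he := by
    obtain ⟨k, i, p, hpi, hip⟩ := exists_splitting_of_isIdempotentElem e.P (congrArg Hom.P he)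
    obtain ⟨l, j, q, hqj, hjq⟩ := exists_splitting_of_isIdempotentElem e.Q (congrArg Hom.Q he)
    have key1 : ∀ M : Matrix X.Row X.Col F, e.P * M = M * e.Q → i * (p * M * j) = M * j := by
      intro M hM
      rw [← Matrix.mul_assoc, ← Matrix.mul_assoc, hip, hM, ← hjq, Matrix.mul_assoc,
        Matrix.mul_assoc, hqj, Matrix.mul_one]
    have key2 : ∀ M : Matrix X.Row X.Col F, e.P * M = M * e.Q → p * M = p * M * j * q := by
      intro M hM
      rw [Matrix.mul_assoc _ j, hjq, Matrix.mul_assoc, ← hM, ← hip, ← Matrix.mul_assoc,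
        ← Matrix.mul_assoc, hpi, Matrix.one_mul]
    exact ⟨⟨Fin k, Fin l, p * X.A * j, p * X.B * j⟩, ⟨i, j, key1 _ e.hA, key1 _ e.hB⟩,
      ⟨p, q, key2 _ e.hA, key2 _ e.hB⟩, hom_ext hpi hqj, hom_ext hip hjq⟩

/-- Isomorphisms from pairs of mutually inverse matrices. -/
theorem nonempty_iso_of_mul_eq_one {X Y : Pencil F} {P : Matrix Y.Row X.Row F}
    {P' : Matrix X.Row Y.Row F} {Q : Matrix Y.Col X.Col F} {Q' : Matrix X.Col Y.Col F}
    (h1 : P * P' = 1) (h2 : P' * P = 1) (h3 : Q * Q' = 1) (h4 : Q' * Q = 1)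
    (hA : P * X.A = Y.A * Q) (hB : P * X.B = Y.B * Q) : Nonempty (X ≅ Y) := by
  have key : ∀ (M : Matrix X.Row X.Col F) (N : Matrix Y.Row Y.Col F), P * M = N * Q →
      P' * N = M * Q' := by
    intro M N h
    rw [← Matrix.mul_one N, ← h3, ← Matrix.mul_assoc N, ← h, ← Matrix.mul_assoc, ← Matrix.mul_assoc,
      h2, Matrix.one_mul]
  exact ⟨⟨⟨P, Q, hA, hB⟩, ⟨P', Q', key _ _ hA, key _ _ hB⟩, hom_ext h2 h4, hom_ext h1 h3⟩⟩

theorem nonempty_iso_reindex {I I' J J' : Type} [Fintype I] [Fintype I'] [Fintype J] [Fintype J']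
    [DecidableEq I] [DecidableEq I'] [DecidableEq J] [DecidableEq J'] (e : I ≃ I') (f : J ≃ J')
    (A B : Matrix I J F) :
    Nonempty ((⟨I, J, A, B⟩ : Pencil F) ≅ ⟨I', J', reindex e f A, reindex e f B⟩) := by
  have key : ∀ M : Matrix I J F, (1 : Matrix I I F).submatrix e.symm id * M =
      reindex e f M * (1 : Matrix J J F).submatrix f.symm id := by
    intro M
    rw [reindex_apply, submatrix_mul_equiv, Matrix.mul_one]
    ext i j
    simp [Matrix.mul_apply, Matrix.one_apply]
  refine nonempty_iso_of_mul_eq_one (P := (1 : Matrix I I F).submatrix e.symm id)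
    (P' := (1 : Matrix I I F).submatrix id e.symm) (Q := (1 : Matrix J J F).submatrix f.symm id)
    (Q' := (1 : Matrix J J F).submatrix id f.symm) ?_ ?_ ?_ ?_ (key A) (key B)
  · ext i j; simp [Matrix.mul_apply, Matrix.one_apply]
  · rw [submatrix_mul_equiv]; simp
  · ext i j; simp [Matrix.mul_apply, Matrix.one_apply]
  · rw [submatrix_mul_equiv]; simp

end Pencil
end PencilCategory

section Chains
open CategoryTheory CategoryTheory.Limits
universe u

namespace Pencil

variable {F : Type u} [Field F]

/-- The pencil with `m` rows and `n` columns whose matrices are the two shifted identities. -/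
def chain (F : Type u) [Field F] (m n : ℕ) : Pencil F :=
  ⟨Fin m, Fin n, of fun i j => if (i : ℕ) + 1 = j then 1 else 0,
    of fun i j => if (i : ℕ) = j then 1 else 0⟩

section
variable {I : Type*} {m n : ℕ} {a b : ℕ}

theorem mul_shift (M : Matrix I (Fin m) F) (x : I) (i : Fin m) (j : Fin n) (h : (i : ℕ) + a = j) :
    (M * (of fun i j => if (i : ℕ) + a = j then 1 else 0 : Matrix (Fin m) (Fin n) F)) x j =
      M x i := by
  rw [Matrix.mul_apply, Finset.sum_eq_single i]
  · simp [h]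
  · intro k _ hk
    have : (k : ℕ) + a ≠ j := fun h' => hk (Fin.ext (by omega))
    simp [this]
  · simp

theorem mul_shift_eq_zero (M : Matrix I (Fin m) F) (x : I) (j : Fin n)
    (h : ∀ i : Fin m, (i : ℕ) + a ≠ j) :
    (M * (of fun i j => if (i : ℕ) + a = j then 1 else 0 : Matrix (Fin m) (Fin n) F)) x j = 0 := by
  rw [Matrix.mul_apply]
  exact Finset.sum_eq_zero fun i _ => by simp [h i]

theorem shift_mul (N : Matrix (Fin n) I F) (x : I) (i : Fin m) (j : Fin n) (h : (i : ℕ) + a = j) :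
    ((of fun i j => if (i : ℕ) + a = j then 1 else 0 : Matrix (Fin m) (Fin n) F) * N) i x =
      N j x := by
  rw [Matrix.mul_apply, Finset.sum_eq_single j]
  · simp [h]
  · intro k _ hk
    have : (i : ℕ) + a ≠ k := fun h' => hk (Fin.ext (by omega))
    simp [this]
  · simp

theorem shift_mul_eq_zero (N : Matrix (Fin n) I F) (x : I) (i : Fin m) (h : n ≤ (i : ℕ) + a) :
    ((of fun i j => if (i : ℕ) + a = j then 1 else 0 : Matrix (Fin m) (Fin n) F) * N) i x = 0 := by
  rw [Matrix.mul_apply]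
  refine Finset.sum_eq_zero fun j _ => ?_
  have : (i : ℕ) + a ≠ j := by omega
  simp [this]

end

section
variable {m n : ℕ}

theorem chain_hom_entry (hm : m ≤ n + 1) (f : chain F m (n + 1) ⟶ chain F m (n + 1))
    (i : Fin m) (j : Fin m) : f.P i j = f.Q (i.castLE hm) (j.castLE hm) := by
  have h := congrFun (congrFun f.hB i) (j.castLE hm)
  exact (mul_shift (a := 0) f.P i j (j.castLE hm) rfl).symm.trans
    (h.trans (shift_mul (a := 0) f.Q (j.castLE hm) i (i.castLE hm) rfl))

theorem chain_hom_zero (hn : n ≤ m) (f : chain F m (n + 1) ⟶ chain F m (n + 1)) (i : Fin n) :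
    f.Q i.succ (0 : Fin (n + 1)) = 0 := by
  have h := congrFun (congrFun f.hA (i.castLE hn)) (0 : Fin (n + 1))
  exact (shift_mul (a := 1) f.Q (0 : Fin (n + 1)) (i.castLE hn) i.succ rfl).symm.trans
    (h.symm.trans (mul_shift_eq_zero (a := 1) f.P _ _ fun i => by simp))

theorem chain_hom_succ (hn : n ≤ m) (hm : m ≤ n + 1) (f : chain F m (n + 1) ⟶ chain F m (n + 1))
    (i j : Fin n) : f.Q i.succ j.succ = f.Q i.castSucc j.castSucc := by
  have h := congrFun (congrFun f.hA (i.castLE hn)) j.succ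
  exact (shift_mul (a := 1) f.Q j.succ (i.castLE hn) i.succ rfl).symm.trans
    (h.symm.trans ((mul_shift (a := 1) f.P _ (j.castLE hn) j.succ rfl).trans
      (chain_hom_entry hm f _ _)))

theorem chain_hom_ext (hm : m ≤ n + 1) {f g : chain F m (n + 1) ⟶ chain F m (n + 1)}
    (h : f.Q = g.Q) : f = g :=
  hom_ext (by
    ext i j
    exact (chain_hom_entry hm f i j).trans ((by rw [h] : _ = _).trans
      (chain_hom_entry hm g i j).symm)) h

theorem chain_idem_eq_zero (hn : n ≤ m) (hm : m ≤ n + 1)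
    (f : chain F m (n + 1) ⟶ chain F m (n + 1)) (hf : f ≫ f = f)
    (h0 : f.Q (0 : Fin (n + 1)) (0 : Fin (n + 1)) = 0) : f = 0 := by
  have key : ∀ j : Fin (n + 1), ∀ i : Fin (n + 1), f.Q i j = 0 := by
    intro j
    induction j using Fin.induction with
    | zero => exact fun i => Fin.cases h0 (chain_hom_zero hn f) i
    | succ j ih =>
      have hs : ∀ i : Fin n, f.Q i.succ j.succ = 0 := fun i =>
        (chain_hom_succ hn hm f i j).trans (ih _)
      refine fun i => Fin.cases ?_ hs i
      have h : (f.Q * f.Q) (0 : Fin (n + 1)) j.succ = f.Q (0 : Fin (n + 1)) j.succ :=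
        congrFun (congrFun (congrArg Hom.Q hf) _) _
      refine h.symm.trans ?_
      have e : (f.Q * f.Q) (0 : Fin (n + 1)) j.succ = ∑ k : Fin (n + 1),
        f.Q (0 : Fin (n + 1)) k * f.Q k j.succ := rfl
      rw [e, Fin.sum_univ_succ, h0, zero_mul, zero_add]
      exact Finset.sum_eq_zero fun i _ => by rw [hs, mul_zero]
  exact chain_hom_ext hm (by ext i j; exact key j i)

theorem chain_comp_zero (hn : n ≤ m) (f g : chain F m (n + 1) ⟶ chain F m (n + 1)) :
    (f ≫ g).Q (0 : Fin (n + 1)) (0 : Fin (n + 1)) =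
      g.Q (0 : Fin (n + 1)) (0 : Fin (n + 1)) * f.Q (0 : Fin (n + 1)) (0 : Fin (n + 1)) := by
  have e : (f ≫ g).Q (0 : Fin (n + 1)) (0 : Fin (n + 1)) = ∑ k : Fin (n + 1),
      g.Q (0 : Fin (n + 1)) k * f.Q k (0 : Fin (n + 1)) := rfl
  rw [e, Fin.sum_univ_succ, Finset.sum_eq_zero fun i _ => by rw [chain_hom_zero hn, mul_zero],
    add_zero]

theorem chain_isIndec (hn : n ≤ m) (hm : m ≤ n + 1) : IsIndec (chain F m (n + 1)) where
  ne_zero h := by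
    have := congrFun (congrFun (congrArg Hom.Q h) (0 : Fin (n + 1))) (0 : Fin (n + 1))
    exact one_ne_zero (α := F) ((Matrix.one_apply_eq (0 : Fin (n + 1))).symm.trans this)
  idem e he := by
    have h := chain_comp_zero hn e e
    rw [he] at h
    by_cases h0 : e.Q (0 : Fin (n + 1)) (0 : Fin (n + 1)) = 0
    · exact Or.inl (chain_idem_eq_zero hn hm e he h0)
    · right
      have h1 : e.Q (0 : Fin (n + 1)) (0 : Fin (n + 1)) = 1 :=
        mul_left_cancel₀ h0 (h.symm.trans (mul_one _).symm)
      have h2 : 𝟙 _ - e = 0 := by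
        refine chain_idem_eq_zero hn hm _ ?_ ?_
        · simp [Preadditive.sub_comp, Preadditive.comp_sub, he]
        · rw [sub_eq_add_neg]
          refine (congrArg₂ (fun x y : F => x + -y) (Matrix.one_apply_eq (0 : Fin (n + 1))) h1).trans ?_
          simp
      exact (sub_eq_zero.1 h2).symm

theorem chain_isIso [Finite F] (hn : n ≤ m) (hm : m ≤ n + 1)
    (f : chain F m (n + 1) ⟶ chain F m (n + 1))
    (h0 : f.Q (0 : Fin (n + 1)) (0 : Fin (n + 1)) ≠ 0) : IsIso f := by
  rcases (chain_isIndec hn hm).isIso_or_pow_eq_zero f with h | ⟨k, hk⟩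
  · exact h
  · exfalso
    have key : ∀ k : ℕ, Hom.Q (X := chain F m (n + 1)) (Y := chain F m (n + 1))
        ((show End (chain F m (n + 1)) from f) ^ k) (0 : Fin (n + 1)) (0 : Fin (n + 1)) ≠ 0 := by
      intro k
      induction k with
      | zero =>
        refine fun h => one_ne_zero (α := F) ((Matrix.one_apply_eq (0 : Fin (n + 1))).symm.trans h)
      | succ k ih =>
        rw [pow_succ, End.mul_def]
        refine fun h => (mul_ne_zero ih h0) ?_
        exact (chain_comp_zero hn f _).symm.trans h
    refine key k ?_
    have h := congrFun (congrFun (congrArg Hom.Q hk) (0 : Fin (n + 1))) (0 : Fin (n + 1))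
    exact h

end

end Pencil
end Chains

section Retracts
open CategoryTheory CategoryTheory.Limits
universe u

namespace Pencil

variable {F : Type u} [Field F]

theorem exists_mulVec_eq_or_exists_vecMul_eq_zero {I J : Type*} [Fintype I] [Fintype J]
    (T : Matrix I J F) (x : I → F) :
    (∃ u, T *ᵥ u = x) ∨ ∃ y, y ᵥ* T = 0 ∧ y ⬝ᵥ x ≠ 0 := by
  classical
  by_cases hx : x ∈ LinearMap.range T.mulVecLin
  · exact Or.inl hx
  · right
    obtain ⟨f, hf, hr⟩ := Submodule.exists_le_ker_of_notMem hx
    have key : ∀ z, (fun i => f (Pi.single i 1)) ⬝ᵥ z = f z := by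
      intro z
      rw [LinearMap.pi_apply_eq_sum_univ f z]
      refine Finset.sum_congr rfl fun i _ => ?_
      rw [mul_comm, smul_eq_mul]
      refine congrArg (fun v => z i * f v) (funext fun j => ?_)
      simp [Pi.single_apply, eq_comm]
    refine ⟨fun i => f (Pi.single i 1), ?_, by rwa [key]⟩
    refine dotProduct_eq _ _ fun u => ?_
    rw [← dotProduct_mulVec, key, zero_dotProduct]
    exact hr ⟨u, rfl⟩

/-- The Fredholm alternative for chains of vectors and chains of covectors. -/
theorem exists_chain_or_exists_cochain {I J : Type*} [Fintype I] [Fintype J]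
    (A B : Matrix I J F) (k m : ℕ) (w : I → F) :
    (∃ u : ℕ → J → F, (∀ i, k ≤ i → u i = 0) ∧
      (0 < m → A *ᵥ u 0 = w) ∧ ∀ i, i + 1 < m → A *ᵥ u (i + 1) = B *ᵥ u i) ∨
    ∃ ψ : ℕ → I → F, (∀ i, m ≤ i → ψ i = 0) ∧ ψ 0 ⬝ᵥ w ≠ 0 ∧
      ∀ i, i < k → ψ i ᵥ* A = ψ (i + 1) ᵥ* B := by
  rcases exists_mulVec_eq_or_exists_vecMul_eq_zero
    (of fun p q => (if (p.1 : ℕ) = q.1 then A p.2 q.2 else 0) -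
      (if (p.1 : ℕ) = q.1 + 1 then B p.2 q.2 else 0) : Matrix (Fin m × I) (Fin k × J) F)
    (fun p => if (p.1 : ℕ) = 0 then w p.2 else 0) with ⟨u, hu⟩ | ⟨y, hy, hx⟩
  · left
    let U : ℕ → J → F := fun j c => if h : j < k then u (⟨j, h⟩, c) else 0
    have hU : ∀ j, k ≤ j → U j = 0 := fun j hj => funext fun c => dif_neg (by omega)
    have huU : ∀ q : Fin k × J, u q = U q.1 q.2 := fun q => by simp [U]
    have key : ∀ (i : Fin m) (r : I), (∑ j ∈ Finset.range k,
        ((if (i : ℕ) = j then (A *ᵥ U j) r else 0) - (if (i : ℕ) = j + 1 then (B *ᵥ U j) r else 0)))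
        = if (i : ℕ) = 0 then w r else 0 := by
      intro i r
      have h := congrFun hu (i, r)
      rw [← h, ← Fin.sum_univ_eq_sum_range (fun j => (if (i : ℕ) = j then (A *ᵥ U j) r else 0) -
        (if (i : ℕ) = j + 1 then (B *ᵥ U j) r else 0)), mulVec, dotProduct, Fintype.sum_prod_type]
      refine Finset.sum_congr rfl fun j _ => ?_
      simp only [of_apply, huU, sub_mul, ite_mul, zero_mul, Finset.sum_sub_distrib, mulVec,
        dotProduct]
      congr 1 <;> split_ifs <;> simp
    have hsum : ∀ (i : ℕ) (r : I), (∑ j ∈ Finset.range k, if i = j then (A *ᵥ U j) r else 0) =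
        (A *ᵥ U i) r := by
      intro i r
      rw [Finset.sum_ite_eq]
      split_ifs with h
      · rfl
      · rw [hU i (by simpa using h), mulVec_zero]; rfl
    have hsum' : ∀ (i : ℕ) (r : I),
        (∑ j ∈ Finset.range k, if i + 1 = j + 1 then (B *ᵥ U j) r else 0) = (B *ᵥ U i) r := by
      intro i r
      simp only [Nat.add_right_cancel_iff]
      rw [Finset.sum_ite_eq]
      split_ifs with h
      · rfl
      · rw [hU i (by simpa using h), mulVec_zero]; rfl
    refine ⟨U, hU, fun hm => funext fun r => ?_, fun i hi => funext fun r => ?_⟩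
    · have := key ⟨0, hm⟩ r
      rw [Finset.sum_sub_distrib, hsum] at this
      simpa using this
    · have := key ⟨i + 1, hi⟩ r
      rw [Finset.sum_sub_distrib, hsum, hsum'] at this
      simpa [sub_eq_zero] using this
  · right
    let Y : ℕ → I → F := fun i r => if h : i < m then y (⟨i, h⟩, r) else 0
    have hY : ∀ j, m ≤ j → Y j = 0 := fun j hj => funext fun c => dif_neg (by omega)
    have hyY : ∀ q : Fin m × I, y q = Y q.1 q.2 := fun q => by simp [Y]
    refine ⟨Y, hY, ?_, fun j hj => funext fun c => ?_⟩
    · have e : (∑ i ∈ Finset.range m, if 0 = i then Y i ⬝ᵥ w else 0) = Y 0 ⬝ᵥ w := by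
        rw [Finset.sum_ite_eq]
        split_ifs with h
        · rfl
        · rw [hY 0 (by simpa using h), zero_dotProduct]
      rw [← e]
      refine fun h => hx (Eq.trans ?_ h)
      rw [← Fin.sum_univ_eq_sum_range (fun i => if 0 = i then Y i ⬝ᵥ w else 0), dotProduct,
        Fintype.sum_prod_type]
      refine Finset.sum_congr rfl fun i _ => ?_
      simp only [hyY, eq_comm (a := 0), dotProduct]
      split_ifs <;> simp
    · have h := congrFun hy (⟨j, hj⟩, c)
      have e : (∑ i ∈ Finset.range m, ((if i = j then (Y i ᵥ* A) c else 0) -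
          (if i = j + 1 then (Y i ᵥ* B) c else 0))) = 0 := by
        refine Eq.trans ?_ h
        rw [← Fin.sum_univ_eq_sum_range (fun i => (if i = j then (Y i ᵥ* A) c else 0) -
          (if i = j + 1 then (Y i ᵥ* B) c else 0)), vecMul, dotProduct, Fintype.sum_prod_type]
        refine Finset.sum_congr rfl fun i _ => ?_
        simp only [of_apply, hyY, mul_sub, mul_ite, mul_zero, Finset.sum_sub_distrib, vecMul,
          dotProduct]
        congr 1 <;> split_ifs <;> simp
      rw [Finset.sum_sub_distrib, Finset.sum_ite_eq', Finset.sum_ite_eq', sub_eq_zero] at e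
      have h1 : ∀ (M : Matrix I J F) (i : ℕ),
          (if i ∈ Finset.range m then (Y i ᵥ* M) c else 0) = (Y i ᵥ* M) c := by
        intro M i
        split_ifs with h
        · rfl
        · rw [hY i (by simpa using h), zero_vecMul]; rfl
      rwa [h1, h1] at e

end Pencil
end Retracts

section SingularPencils
open CategoryTheory CategoryTheory.Limits
universe u

namespace Pencil

variable {F : Type u} [Field F]

theorem nonempty_retract_of_isIso {X Y : Pencil F} (f : X ⟶ Y) (g : Y ⟶ X) (h : IsIso (f ≫ g)) :
    Nonempty (Retract X Y) :=
  ⟨⟨f, g ≫ inv (f ≫ g), by rw [← Category.assoc, IsIso.hom_inv_id]⟩⟩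

theorem exists_hom_of_chain (X : Pencil F) {m n : ℕ} (hn : n ≤ m) (hm : m ≤ n + 1)
    (v : ℕ → X.Col → F) (h0 : X.A *ᵥ v 0 = 0) (hA : ∀ i < n, X.A *ᵥ v (i + 1) = X.B *ᵥ v i)
    (hB : m = n → X.B *ᵥ v n = 0) :
    ∃ f : chain F m (n + 1) ⟶ X, ∀ c (j : Fin (n + 1)), f.Q c j = v j c := by
  refine ⟨⟨of fun r (i : Fin m) => (X.B *ᵥ v i) r, of fun c (j : Fin (n + 1)) => v j c, ?_, ?_⟩,
    fun _ _ => rfl⟩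
  · ext r j
    refine Fin.cases ?_ (fun i => ?_) (show Fin (n + 1) from j)
    · exact (mul_shift_eq_zero (a := 1) _ _ _ fun i => by simp).trans (congrFun h0 r).symm
    · exact (mul_shift (a := 1) _ _ (i.castLE hn) _ rfl).trans (congrFun (hA i i.2) r).symm
  · ext r j
    by_cases h : (j : Fin (n + 1)).1 < m
    · exact (mul_shift (a := 0) _ _ ⟨_, h⟩ _ rfl)
    · have hj : (j : Fin (n + 1)).1 = n := le_antisymm (Nat.le_of_lt_succ (Fin.is_lt _)) (by omega)
      refine (mul_shift_eq_zero (a := 0) _ _ _ fun i => by omega).trans ?_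
      refine (congrFun (hB (by omega)) r).symm.trans ?_
      exact congrArg (fun k => (X.B *ᵥ v k) r) hj.symm

theorem exists_hom_of_cochain (X : Pencil F) {m n : ℕ} (hn : n ≤ m) (hm : m ≤ n + 1)
    (φ : ℕ → X.Col → F) (ψ : ℕ → X.Row → F) (hB : ∀ i < m, ψ i ᵥ* X.B = φ i)
    (hA : ∀ i < n, ψ i ᵥ* X.A = φ (i + 1)) (h0 : m = n + 1 → ψ n ᵥ* X.A = 0) :
    ∃ g : X ⟶ chain F m (n + 1), ∀ (j : Fin (n + 1)) c, g.Q j c = φ j c := by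
  refine ⟨⟨of fun (i : Fin m) r => ψ i r, of fun (j : Fin (n + 1)) c => φ j c, ?_, ?_⟩,
    fun _ _ => rfl⟩
  · ext i c
    by_cases h : (i : Fin m).1 < n
    · exact (congrFun (hA _ h) c).trans (shift_mul (a := 1)
        (of fun (j : Fin (n + 1)) c => φ j c) c (i : Fin m) (Fin.succ ⟨_, h⟩) rfl).symm
    · have hi : (i : Fin m).1 = n := le_antisymm
        (Nat.le_of_lt_succ (lt_of_lt_of_le (Fin.is_lt _) hm)) (by omega)
      refine Eq.trans ?_ (shift_mul_eq_zero (a := 1) _ _ (i : Fin m) (by omega)).symm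
      refine Eq.trans ?_ (congrFun (h0 (by have := (i : Fin m).2; omega)) c)
      exact congrArg (fun k => (ψ k ᵥ* X.A) c) hi
  · ext i c
    exact (congrFun (hB _ (i : Fin m).2) c).trans
      (shift_mul (a := 0) (of fun (j : Fin (n + 1)) c => φ j c) c (i : Fin m) ((i : Fin m).castLE hm)
        rfl).symm

theorem nonempty_retract_chain [Finite F] (X : Pencil F) {m n : ℕ} (hn : n ≤ m) (hm : m ≤ n + 1)
    (v : ℕ → X.Col → F) (h0 : X.A *ᵥ v 0 = 0) (hA : ∀ i < n, X.A *ᵥ v (i + 1) = X.B *ᵥ v i)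
    (hB : m = n → X.B *ᵥ v n = 0)
    (φ : ℕ → X.Col → F) (ψ : ℕ → X.Row → F) (hφB : ∀ i < m, ψ i ᵥ* X.B = φ i)
    (hφA : ∀ i < n, ψ i ᵥ* X.A = φ (i + 1)) (hφ0 : m = n + 1 → ψ n ᵥ* X.A = 0)
    (h : φ 0 ⬝ᵥ v 0 ≠ 0) : Nonempty (Retract (chain F m (n + 1)) X) := by
  obtain ⟨f, hf⟩ := exists_hom_of_chain X hn hm v h0 hA hB
  obtain ⟨g, hg⟩ := exists_hom_of_cochain X hn hm φ ψ hφB hφA hφ0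
  refine nonempty_retract_of_isIso f g (chain_isIso hn hm _ ?_)
  refine fun h' => h (Eq.trans ?_ h')
  refine Finset.sum_congr rfl fun c _ => ?_
  exact congrArg₂ (· * ·) (hg 0 c).symm (hf c 0).symm

/-- `v 0, …, v n` is a chain of vectors starting in the kernel of the first matrix. -/
def IsChainVec (X : Pencil F) (n : ℕ) (v : ℕ → X.Col → F) : Prop :=
  v 0 ≠ 0 ∧ X.A *ᵥ v 0 = 0 ∧ ∀ i < n, X.A *ᵥ v (i + 1) = X.B *ᵥ v i

theorem IsChainVec.cons {X : Pencil F} {n m : ℕ} {v u : ℕ → X.Col → F} (hv : X.IsChainVec n v)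
    (h0 : 0 < m → X.A *ᵥ u 0 = X.B *ᵥ v 0)
    (h1 : ∀ i, i + 1 < m → X.A *ᵥ u (i + 1) = X.B *ᵥ u i) :
    X.IsChainVec m (fun i => Nat.casesOn i (v 0) u) := by
  refine ⟨hv.1, hv.2.1, fun i hi => ?_⟩
  cases i with
  | zero => exact h0 hi
  | succ i => exact h1 i hi

theorem exists_isChainVec_closed [Finite F] (X : Pencil F)
    (h : ∀ n, ∃ v, X.IsChainVec n v) : ∃ n v, X.IsChainVec n v ∧ X.B *ᵥ v n = 0 := by
  obtain ⟨v, hv⟩ := h (Nat.card (X.Col → F))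
  have : ¬ Function.Injective fun i : Fin (Nat.card (X.Col → F) + 1) => v i := by
    intro hinj
    have := Nat.card_le_card_of_injective _ hinj
    simp at this
  simp only [Function.Injective, not_forall] at this
  obtain ⟨i, j, hij, hne⟩ := this
  wlog hlt : i < j generalizing i j
  · exact this j i hij.symm (Ne.symm hne) (lt_of_le_of_ne (not_lt.1 hlt) (Ne.symm hne))
  have hlt' : (i : ℕ) < j := hlt
  obtain ⟨hv0, hA0, hA⟩ := hv
  refine ⟨j, fun k => v k - if (j : ℕ) - i ≤ k then v (k - (j - i)) else 0, ⟨?_, ?_, ?_⟩, ?_⟩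
  · simpa [show ¬ (j : ℕ) - i ≤ 0 by omega] using hv0
  · simpa [show ¬ (j : ℕ) - i ≤ 0 by omega] using hA0
  · intro k hk
    have hk' : k < Nat.card (X.Col → F) := by omega
    rw [mulVec_sub, mulVec_sub, hA k hk']
    congr 1
    by_cases h1 : (j : ℕ) - i ≤ k
    · rw [if_pos h1, if_pos (by omega), show k + 1 - ((j : ℕ) - i) = k - (j - i) + 1 by omega,
        hA _ (by omega)]
    · rw [if_neg h1, mulVec_zero]
      split_ifs with h2
      · rw [show k + 1 - ((j : ℕ) - i) = 0 by omega, hA0]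
      · exact mulVec_zero _
  · have : v j - (if (j : ℕ) - i ≤ j then v (j - (j - i)) else 0) = 0 := by
      rw [if_pos (by omega), show (j : ℕ) - (j - i) = i by omega, sub_eq_zero]
      exact hij.symm
    simp only [this, mulVec_zero]

theorem exists_retract_of_mulVec_eq_zero [Finite F] (X : Pencil F) (v₀ : X.Col → F) (hv₀ : v₀ ≠ 0)
    (hA₀ : X.A *ᵥ v₀ = 0) :
    ∃ n, Nonempty (Retract (chain F n (n + 1)) X) ∨
      Nonempty (Retract (chain F (n + 1) (n + 1)) X) := by
  by_cases hK : ∃ n v, X.IsChainVec n v ∧ X.B *ᵥ v n = 0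
  · classical
    obtain ⟨v, hv, hBv⟩ := Nat.find_spec hK
    have hmin := fun {m} => Nat.find_min (m := m) hK
    refine ⟨Nat.find hK, Or.inl ?_⟩
    generalize Nat.find hK = n at *
    rcases Nat.eq_zero_or_pos n with rfl | hpos
    · obtain ⟨c, hc⟩ := Function.ne_iff.1 hv.1
      exact nonempty_retract_chain X le_rfl (by omega) v hv.2.1 hv.2.2 (fun _ => hBv)
        (fun _ => Pi.single c 1) 0 (by simp) (by simp) (by simp) (by simpa using hc)
    · rcases exists_chain_or_exists_cochain X.A X.B (n - 1) n (X.B *ᵥ v 0) with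
        ⟨u, hu, h0, h1⟩ | ⟨ψ, hψ, h0, h1⟩
      · refine absurd ⟨_, hv.cons (m := n - 1) (fun _ => h0 hpos) fun i hi => h1 i (by omega), ?_⟩
          (hmin (m := n - 1) (by omega))
        obtain ⟨k, rfl⟩ : ∃ k, n = k + 1 := ⟨n - 1, by omega⟩
        cases k with
        | zero =>
          refine (h0 one_pos).symm.trans ?_
          rw [hu 0 (by omega), mulVec_zero]
        | succ k =>
          refine (h1 k (by omega)).symm.trans ?_
          rw [hu (k + 1) (by omega), mulVec_zero]
      · refine nonempty_retract_chain X le_rfl (by omega) v hv.2.1 hv.2.2 (fun _ => hBv)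
          (fun i => if i < n then ψ i ᵥ* X.B else ψ (n - 1) ᵥ* X.A) ψ (fun i hi => ?_)
          (fun i hi => ?_) (by omega) ?_
        · rw [if_pos hi]
        · split_ifs with h
          · exact h1 i (by omega)
          · rw [show i = n - 1 by omega]
        · rw [if_pos hpos, ← dotProduct_mulVec]
          exact h0
  · have hex : ∃ n, ∀ v, ¬ X.IsChainVec n v := by
      by_contra! h
      exact hK (exists_isChainVec_closed X h)
    classical
    have hn := Nat.find_spec hex
    have hmin := fun {m} => Nat.find_min (m := m) hex
    generalize Nat.find hex = n at *
    have hn0 : n ≠ 0 := by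
      rintro rfl
      exact hn (fun _ => v₀) ⟨hv₀, hA₀, by simp⟩
    obtain ⟨k, rfl⟩ : ∃ k, n = k + 1 := ⟨n - 1, by omega⟩
    have hk := hmin (m := k) (by omega)
    push Not at hk
    obtain ⟨v, hv⟩ := hk
    refine ⟨k, Or.inr ?_⟩
    rcases exists_chain_or_exists_cochain X.A X.B (k + 1) (k + 1) (X.B *ᵥ v 0) with
      ⟨u, hu, h0, h1⟩ | ⟨ψ, hψ, h0, h1⟩
    · exact absurd (hv.cons (m := k + 1) h0 h1) (hn _)
    · refine nonempty_retract_chain X (by omega) le_rfl v hv.2.1 hv.2.2 (by omega)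
        (fun i => ψ i ᵥ* X.B) ψ (fun i hi => rfl) (fun i hi => h1 i (by omega)) (fun _ => ?_) ?_
      · rw [h1 k (by omega), hψ _ le_rfl, zero_vecMul]
      · rw [← dotProduct_mulVec]
        exact h0

end Pencil
end SingularPencils

section CompanionMatrices
universe u
variable {F : Type u} [Field F]

theorem companion_eq_leftMulMatrix {q : F[X]} (hq : q.Monic) :
    companion F q = Algebra.leftMulMatrix (AdjoinRoot.powerBasisAux' hq) (AdjoinRoot.root q) := by
  refine Eq.trans ?_ (AdjoinRoot.powerBasis' hq).leftMulMatrix.symm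
  have h : (AdjoinRoot.powerBasis' hq).minpolyGen = q := by
    rw [PowerBasis.minpolyGen_eq, AdjoinRoot.powerBasis'_gen, AdjoinRoot.minpoly_root hq.ne_zero,
      hq.leadingCoeff]
    simp
  ext i j
  rw [h]
  change (if (i : ℕ) = j + 1 then (1 : F) else if (j : ℕ) + 1 = q.natDegree then -q.coeff i else 0) =
    if (j : ℕ) + 1 = q.natDegree then -q.coeff i else if (i : ℕ) = j + 1 then 1 else 0
  have hi := i.2
  by_cases h1 : (i : ℕ) = j + 1
  · rw [if_pos h1, if_neg (by omega), if_pos h1]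
  · rw [if_neg h1, if_neg h1]

theorem aeval_companion {q : F[X]} (hq : q.Monic) (f : F[X]) :
    aeval (companion F q) f =
      Algebra.leftMulMatrix (AdjoinRoot.powerBasisAux' hq) (AdjoinRoot.mk q f) := by
  rw [companion_eq_leftMulMatrix hq, aeval_algHom_apply, AdjoinRoot.aeval_eq]

theorem aeval_companion_eq_zero_iff {q : F[X]} (hq : q.Monic) (f : F[X]) :
    aeval (companion F q) f = 0 ↔ q ∣ f := by
  rw [aeval_companion hq, map_eq_zero_iff _ (Algebra.leftMulMatrix_injective (AdjoinRoot.powerBasisAux' hq)),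
    AdjoinRoot.mk_eq_zero]

theorem exists_eq_aeval_companion {q : F[X]} (hq : q.Monic) {Q : Mat F q.natDegree}
    (hQ : Q * companion F q = companion F q * Q) : ∃ f : F[X], Q = aeval (companion F q) f := by
  let b := AdjoinRoot.powerBasisAux' hq
  let φ := Matrix.toLin b b Q
  have hφ : ∀ x, φ (AdjoinRoot.root q * x) = AdjoinRoot.root q * φ x := by
    have h := congrArg (Matrix.toLin b b) hQ
    rw [Matrix.toLin_mul b b b, Matrix.toLin_mul b b b, companion_eq_leftMulMatrix hq,
      Algebra.leftMulMatrix_apply, Matrix.toLin_toMatrix] at h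
    exact fun x => LinearMap.congr_fun h x
  have key : ∀ f : F[X], φ (AdjoinRoot.mk q f) = AdjoinRoot.mk q f * φ 1 := by
    intro f
    induction f using Polynomial.induction_on' with
    | add f g hf hg => rw [map_add, map_add, hf, hg, add_mul]
    | monomial n a =>
      induction n with
      | zero =>
        rw [Polynomial.monomial_zero_left, AdjoinRoot.mk_C, ← AdjoinRoot.algebraMap_eq,
          ← Algebra.smul_def, Algebra.algebraMap_eq_smul_one, map_smul]
      | succ n ih =>
        rw [← Polynomial.X_mul_monomial, map_mul, AdjoinRoot.mk_X, hφ, ih, mul_assoc]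
  obtain ⟨f, hf⟩ := AdjoinRoot.mk_surjective (φ 1)
  refine ⟨f, ?_⟩
  rw [aeval_companion hq, hf, Algebra.leftMulMatrix_apply, ← LinearMap.toMatrix_toLin b b Q]
  congr 1
  refine LinearMap.ext fun x => ?_
  obtain ⟨g, rfl⟩ := AdjoinRoot.mk_surjective x
  exact (key g).trans (mul_comm _ _)

end CompanionMatrices

section RegularPencils
open CategoryTheory CategoryTheory.Limits
universe u

/-- A power of a monic irreducible polynomial with positive exponent. -/
def IsPrimaryPoly {F : Type u} [Field F] (q : F[X]) : Prop :=
  ∃ (p : F[X]) (l : ℕ), p.Monic ∧ Irreducible p ∧ 0 < l ∧ q = p ^ l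

namespace Pencil

variable {F : Type u} [Field F]

theorem _root_.Can.IsPrimaryPoly.monic {q : F[X]} (hq : IsPrimaryPoly q) : q.Monic := by
  obtain ⟨p, l, hp, -, -, rfl⟩ := hq
  exact hp.pow l

/-- The pencil of an identity matrix and a square matrix. -/
def ofMatrix {I : Type} [Fintype I] [DecidableEq I] (T : Matrix I I F) : Pencil F := ⟨I, I, 1, T⟩

/-- The pencil of an identity matrix and a companion matrix. -/
def frob (q : F[X]) : Pencil F := ofMatrix (companion F q)

theorem ofMatrix_hom {I J : Type} [Fintype I] [DecidableEq I] [Fintype J] [DecidableEq J]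
    {S : Matrix I I F} {T : Matrix J J F} (f : ofMatrix S ⟶ ofMatrix T) :
    ∃ Q : Matrix J I F, f.P = Q ∧ f.Q = Q ∧ Q * S = T * Q := by
  let P : Matrix J I F := f.P
  let Q : Matrix J I F := f.Q
  have hA : P * (1 : Matrix I I F) = (1 : Matrix J J F) * Q := f.hA
  have hB : P * S = T * Q := f.hB
  rw [Matrix.mul_one, Matrix.one_mul] at hA
  exact ⟨Q, hA, rfl, by rw [← hB, hA]⟩

theorem frob_isIndec {q : F[X]} (hq : IsPrimaryPoly q) : IsIndec (frob q) where
  ne_zero h := by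
    have h1 : aeval (companion F q) (1 : F[X]) = 0 := by
      rw [map_one]
      exact congrArg Hom.Q h
    rw [aeval_companion_eq_zero_iff hq.monic] at h1
    obtain ⟨p, l, -, hp, hl, rfl⟩ := hq
    exact hp.not_isUnit (isUnit_of_dvd_one ((dvd_pow_self p hl.ne').trans h1))
  idem e he := by
    obtain ⟨Q, hP, hQ, hc⟩ := ofMatrix_hom e
    obtain ⟨f, rfl⟩ := exists_eq_aeval_companion hq.monic hc
    have hQQ : aeval (companion F q) f * aeval (companion F q) f = aeval (companion F q) f :=
      (congrArg₂ (fun M N : Mat F q.natDegree => M * N) hQ.symm hQ.symm).trans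
        ((congrArg Hom.Q he).trans hQ)
    have hdvd : q ∣ f * (f - 1) := by
      rw [← aeval_companion_eq_zero_iff hq.monic, map_mul, map_sub, map_one, mul_sub, mul_one, hQQ,
        sub_self]
    have hcases : q ∣ f ∨ q ∣ f - 1 := by
      obtain ⟨p, l, -, hp, hl, rfl⟩ := hq
      by_cases h : p ∣ f
      · left
        refine hp.prime.pow_dvd_of_dvd_mul_right l (fun h' => hp.not_isUnit ?_) hdvd
        exact isUnit_of_dvd_one (by simpa using dvd_sub h h')
      · exact Or.inr (hp.prime.pow_dvd_of_dvd_mul_left l h hdvd)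
    refine hcases.imp (fun h => ?_) fun h => ?_
    · rw [← aeval_companion_eq_zero_iff hq.monic] at h
      exact hom_ext (hP.trans h) (hQ.trans h)
    · rw [← aeval_companion_eq_zero_iff hq.monic, map_sub, map_one, sub_eq_zero] at h
      exact hom_ext (hP.trans h) (hQ.trans h)

theorem aeval_mul_of_mul_eq {I J : Type} [Fintype I] [DecidableEq I] [Fintype J] [DecidableEq J]
    {S : Matrix I I F} {T : Matrix J J F} {Q : Matrix J I F} (h : Q * S = T * Q) (f : F[X]) :
    Q * aeval S f = aeval T f * Q := by
  induction f using Polynomial.induction_on' with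
  | add f g hf hg => rw [map_add, map_add, Matrix.mul_add, Matrix.add_mul, hf, hg]
  | monomial n a =>
    have hn : Q * S ^ n = T ^ n * Q := by
      induction n with
      | zero => simp
      | succ n ih => rw [pow_succ, ← Matrix.mul_assoc, ih, Matrix.mul_assoc, h, ← Matrix.mul_assoc,
          ← pow_succ]
    rw [aeval_monomial, aeval_monomial, ← Algebra.smul_def, ← Algebra.smul_def, Matrix.mul_smul, hn,
      Matrix.smul_mul]

theorem aeval_eq_zero_of_iso {I J : Type} [Fintype I] [DecidableEq I] [Fintype J] [DecidableEq J]
    {S : Matrix I I F} {T : Matrix J J F} (φ : ofMatrix S ≅ ofMatrix T) {f : F[X]}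
    (hf : aeval S f = 0) : aeval T f = 0 := by
  obtain ⟨Q, -, hQ, hc⟩ := ofMatrix_hom φ.hom
  obtain ⟨R, -, hR, -⟩ := ofMatrix_hom φ.inv
  have h1 : Q * R = 1 := (congrArg₂ (fun (M : Matrix J I F) (N : Matrix I J F) => M * N)
    hQ.symm hR.symm).trans (congrArg Hom.Q φ.inv_hom_id)
  rw [← Matrix.mul_one (aeval T f), ← h1, ← Matrix.mul_assoc, ← aeval_mul_of_mul_eq hc, hf,
    Matrix.mul_zero, Matrix.zero_mul]

theorem frob_injective {q q' : F[X]} (hq : q.Monic) (hq' : q'.Monic) (φ : frob q ≅ frob q') :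
    q = q' := by
  refine Polynomial.eq_of_monic_of_associated hq hq' (associated_of_dvd_dvd ?_ ?_)
  · rw [← aeval_companion_eq_zero_iff hq]
    exact aeval_eq_zero_of_iso φ.symm ((aeval_companion_eq_zero_iff hq' _).2 dvd_rfl)
  · rw [← aeval_companion_eq_zero_iff hq']
    exact aeval_eq_zero_of_iso φ ((aeval_companion_eq_zero_iff hq _).2 dvd_rfl)

open DirectSum in
theorem exists_retract_module {V : Type u} [AddCommGroup V]
    [Module F[X] V] [Module.Finite F[X] V] [Nontrivial V] (hV : Module.IsTorsion F[X] V) :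
    ∃ (q : F[X]), IsPrimaryPoly q ∧ ∃ (i : (F[X] ⧸ Ideal.span {q}) →ₗ[F[X]] V)
      (r : V →ₗ[F[X]] (F[X] ⧸ Ideal.span {q})),
      r ∘ₗ i = LinearMap.id := by
  classical
  obtain ⟨ι, _, p, hp, e, ⟨ψ⟩⟩ := Module.equiv_directSum_of_isTorsion hV
  obtain ⟨j, hj⟩ : ∃ j, e j ≠ 0 := by
    by_contra! h
    have : ∀ j, Subsingleton (F[X] ⧸ Submodule.span F[X] {p j ^ e j}) := fun j => by
      rw [h j, pow_zero, Submodule.Quotient.subsingleton_iff]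
      exact Ideal.span_singleton_one
    exact not_subsingleton V (ψ.injective.subsingleton)
  have hassoc : Associated (p j ^ e j) (normalize (p j) ^ e j) := (normalize_associated _).symm.pow_pow
  refine ⟨normalize (p j) ^ e j, ⟨_, _, Polynomial.monic_normalize (hp j).ne_zero,
    (normalize_associated (p j)).irreducible_iff.2 (hp j), Nat.pos_of_ne_zero hj, rfl⟩, ?_⟩
  have hspan : Submodule.span F[X] {p j ^ e j} = Ideal.span {normalize (p j) ^ e j} :=
    Ideal.span_singleton_eq_span_singleton.2 hassoc
  let θ : (F[X] ⧸ Submodule.span F[X] {p j ^ e j}) ≃ₗ[F[X]]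
      (F[X] ⧸ Ideal.span {normalize (p j) ^ e j}) :=
    Submodule.quotEquivOfEq _ _ hspan
  refine ⟨ψ.symm.toLinearMap ∘ₗ DirectSum.lof F[X] ι _ j ∘ₗ θ.symm.toLinearMap,
    θ.toLinearMap ∘ₗ DirectSum.component F[X] ι _ j ∘ₗ ψ.toLinearMap, ?_⟩
  refine LinearMap.ext fun x => ?_
  simp [DirectSum.component.lof_self]

theorem exists_retract_frob {J : Type} [Fintype J] [DecidableEq J] [Nonempty J]
    (T : Matrix J J F) : ∃ q : F[X], IsPrimaryPoly q ∧ Nonempty (Retract (frob q) (ofMatrix T)) := by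
  let t : (J → F) →ₗ[F] (J → F) := toLin' T
  have : Nontrivial (Module.AEval' t) := (Module.AEval'.of t).symm.toEquiv.nontrivial
  obtain ⟨q, hq, i, r, hri⟩ := exists_retract_module (V := Module.AEval' t)
    (Module.AEval.isTorsion_of_finiteDimensional F (J → F) t)
  refine ⟨q, hq, ?_⟩
  let b := AdjoinRoot.powerBasisAux' hq.monic
  let i' : AdjoinRoot q →ₗ[F] (J → F) :=
    (Module.AEval'.of t).symm.toLinearMap ∘ₗ i.restrictScalars F
  let r' : (J → F) →ₗ[F] AdjoinRoot q :=
    r.restrictScalars F ∘ₗ (Module.AEval'.of t).toLinearMap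
  have hroot : ∀ x : F[X] ⧸ Ideal.span {q}, (X : F[X]) • x =
      (show F[X] ⧸ Ideal.span {q} from AdjoinRoot.root q * (show AdjoinRoot q from x)) := by
    intro x
    obtain ⟨f, rfl⟩ := AdjoinRoot.mk_surjective (g := q) x
    rfl
  have hi : ∀ x, i' (AdjoinRoot.root q * x) = t (i' x) := by
    intro x
    change (Module.AEval'.of t).symm (i _) = t ((Module.AEval'.of t).symm (i x))
    exact (congrArg (fun y => (Module.AEval'.of t).symm (i y)) (hroot x).symm).trans
      ((congrArg (Module.AEval'.of t).symm (i.map_smul (X : F[X]) (show F[X] ⧸ Ideal.span {q} from x))).trans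
        (Module.AEval'.of_symm_X_smul _ _))
  have hr : ∀ v, r' (t v) = AdjoinRoot.root q * r' v := by
    intro v
    change r (Module.AEval'.of t (t v)) = _
    rw [← Module.AEval'.X_smul_of, map_smul]
    exact hroot _
  have hri' : r' ∘ₗ i' = LinearMap.id := LinearMap.ext fun x => by
    change r (Module.AEval'.of t ((Module.AEval'.of t).symm (i x))) = x
    rw [LinearEquiv.apply_symm_apply]
    exact LinearMap.congr_fun hri x
  have hI : LinearMap.toMatrix b (Pi.basisFun F J) i' * companion F q =
      T * LinearMap.toMatrix b (Pi.basisFun F J) i' := by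
    rw [companion_eq_leftMulMatrix hq.monic, Algebra.leftMulMatrix_apply,
      ← LinearMap.toMatrix_comp b b (Pi.basisFun F J)]
    conv_rhs => rw [← LinearMap.toMatrix'_toLin' T, ← LinearMap.toMatrix_eq_toMatrix',
      ← LinearMap.toMatrix_comp b (Pi.basisFun F J) (Pi.basisFun F J)]
    congr 1
    exact LinearMap.ext hi
  have hR : LinearMap.toMatrix (Pi.basisFun F J) b r' * T =
      companion F q * LinearMap.toMatrix (Pi.basisFun F J) b r' := by
    rw [companion_eq_leftMulMatrix hq.monic, Algebra.leftMulMatrix_apply,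
      ← LinearMap.toMatrix_comp (Pi.basisFun F J) b b]
    conv_lhs => rw [← LinearMap.toMatrix'_toLin' T, ← LinearMap.toMatrix_eq_toMatrix',
      ← LinearMap.toMatrix_comp (Pi.basisFun F J) (Pi.basisFun F J) b]
    congr 1
    exact LinearMap.ext hr
  have hRI : LinearMap.toMatrix (Pi.basisFun F J) b r' * LinearMap.toMatrix b (Pi.basisFun F J) i' =
      1 := by
    rw [← LinearMap.toMatrix_comp b (Pi.basisFun F J) b, hri', LinearMap.toMatrix_id]
  exact ⟨⟨⟨_, _, (Matrix.mul_one _).trans (Matrix.one_mul _).symm, hI⟩,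
    ⟨_, _, (Matrix.mul_one _).trans (Matrix.one_mul _).symm, hR⟩, hom_ext hRI hRI⟩⟩

end Pencil
end RegularPencils

section PencilDuality
open CategoryTheory CategoryTheory.Limits
universe u

namespace Pencil

variable {F : Type u} [Field F]

/-- The conjugate transpose of a pencil. -/
def dual (σ : F →+* F) (X : Pencil F) : Pencil F :=
  ⟨X.Col, X.Row, (X.A.map σ)ᵀ, (X.B.map σ)ᵀ⟩

theorem dual_dual {σ : F →+* F} (hσ : ∀ a, σ (σ a) = a) (X : Pencil F) :
    dual σ (dual σ X) = X := by
  have h : ∀ M : Matrix X.Row X.Col F, (((M.map σ)ᵀ).map σ)ᵀ = M := fun M => by ext; simp [hσ]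
  obtain ⟨R, C, A, B⟩ := X
  simp only [dual]
  congr 1
  · exact h A
  · exact h B

theorem transpose_map_mul {I J K : Type*} [Fintype J] (σ : F →+* F) (M : Matrix I J F)
    (N : Matrix J K F) : ((M * N).map σ)ᵀ = (N.map σ)ᵀ * (M.map σ)ᵀ := by
  rw [Matrix.map_mul, Matrix.transpose_mul]

/-- Conjugate transposition on morphisms. -/
def dualHom (σ : F →+* F) {X Y : Pencil F} (f : X ⟶ Y) : dual σ Y ⟶ dual σ X where
  P := (f.Q.map σ)ᵀ
  Q := (f.P.map σ)ᵀ
  hA := by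
    have := congrArg (fun M => (M.map σ)ᵀ) f.hA
    simp only [transpose_map_mul] at this
    exact this.symm
  hB := by
    have := congrArg (fun M => (M.map σ)ᵀ) f.hB
    simp only [transpose_map_mul] at this
    exact this.symm

theorem dualHom_id (σ : F →+* F) (X : Pencil F) : dualHom σ (𝟙 X) = 𝟙 (dual σ X) := by
  have h : ∀ (I : Type) [Fintype I] [DecidableEq I], ((1 : Matrix I I F).map σ)ᵀ = 1 := by
    intro I _ _
    simp
  exact hom_ext (h X.Col) (h X.Row)

theorem dualHom_zero (σ : F →+* F) (X Y : Pencil F) :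
    dualHom σ (0 : X ⟶ Y) = (0 : dual σ Y ⟶ dual σ X) := by
  have h : ∀ I J : Type, ((0 : Matrix I J F).map σ)ᵀ = 0 := by
    intro I J
    ext
    simp
  exact hom_ext (h _ _) (h _ _)

theorem dualHom_comp (σ : F →+* F) {X Y Z : Pencil F} (f : X ⟶ Y) (g : Y ⟶ Z) :
    dualHom σ (f ≫ g) = dualHom σ g ≫ dualHom σ f :=
  hom_ext (transpose_map_mul σ _ _) (transpose_map_mul σ _ _)

theorem dualHom_injective (σ : F →+* F) (X Y : Pencil F) :
    Function.Injective (dualHom σ : (X ⟶ Y) → (dual σ Y ⟶ dual σ X)) := by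
  intro f g h
  have key : ∀ (I J : Type) (M N : Matrix I J F), (M.map σ)ᵀ = (N.map σ)ᵀ → M = N :=
    fun I J M N h => Matrix.map_injective σ.injective (Matrix.transpose_injective h)
  exact hom_ext (key _ _ _ _ (congrArg Hom.Q h)) (key _ _ _ _ (congrArg Hom.P h))

theorem nonempty_dual_iso (σ : F →+* F) {X Y : Pencil F} (φ : X ≅ Y) :
    Nonempty (dual σ X ≅ dual σ Y) :=
  ⟨⟨dualHom σ φ.inv, dualHom σ φ.hom, by rw [← dualHom_comp, φ.hom_inv_id, dualHom_id],
    by rw [← dualHom_comp, φ.inv_hom_id, dualHom_id]⟩⟩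

theorem nonempty_dual_retract (σ : F →+* F) {X Y : Pencil F} (r : Retract X Y) :
    Nonempty (Retract (dual σ X) (dual σ Y)) :=
  ⟨⟨dualHom σ r.r, dualHom σ r.i, by rw [← dualHom_comp, r.retract, dualHom_id]⟩⟩

theorem dual_isIndec {σ : F →+* F} (hσ : ∀ a, σ (σ a) = a) {X : Pencil F} (hX : IsIndec X) :
    IsIndec (dual σ X) where
  ne_zero h := by
    rw [← dualHom_id, ← dualHom_zero] at h
    exact hX.ne_zero (dualHom_injective σ _ _ h)
  idem e he := by
    have hX' : IsIndec (dual σ (dual σ X)) := by rwa [dual_dual hσ]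
    refine (hX'.idem (dualHom σ e) (by rw [← dualHom_comp, he])).imp (fun h => ?_) fun h => ?_
    · rw [← dualHom_zero] at h
      exact dualHom_injective σ _ _ h
    · rw [← dualHom_id] at h
      exact dualHom_injective σ _ _ h

theorem dual_chain (σ : F →+* F) (m n : ℕ) :
    dual σ (chain F m n) = dual (RingHom.id F) (chain F m n) := by
  simp only [dual, chain]
  congr 1 <;> ext i j <;> simp [apply_ite σ]

theorem nonempty_dual_chain_iso (σ : F →+* F) (n : ℕ) :
    Nonempty (dual σ (chain F n n) ≅ chain F n n) := by
  let X : Pencil F := ⟨Fin n, Fin n, reindex Fin.revPerm Fin.revPerm (dual σ (chain F n n)).A,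
    reindex Fin.revPerm Fin.revPerm (dual σ (chain F n n)).B⟩
  have h : X = chain F n n := by
    simp only [X, dual, chain]
    congr 1
    · ext i j
      simp [apply_ite σ, Fin.val_rev]
      congr 1
      rw [eq_iff_iff]
      omega
    · ext i j
      simp [apply_ite σ, Fin.val_rev]
      congr 1
      rw [eq_iff_iff]
      omega
  exact (nonempty_iso_reindex (F := F) (Fin.revPerm (n := n)) (Fin.revPerm (n := n))
    (dual σ (chain F n n)).A (dual σ (chain F n n)).B).map fun φ => φ ≪≫ eqToIso h

theorem aeval_transpose_map {I : Type*} [Fintype I] [DecidableEq I] (σ : F →+* F) (M : Matrix I I F)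
    (f : F[X]) : aeval ((M.map σ)ᵀ) (f.map σ) = ((aeval M f).map σ)ᵀ := by
  induction f using Polynomial.induction_on' with
  | add f g hf hg =>
    rw [Polynomial.map_add, map_add, map_add, hf, hg, Matrix.map_add σ (map_add σ),
      Matrix.transpose_add]
  | monomial n a =>
    have hn : ((M.map σ)ᵀ) ^ n = ((M ^ n).map σ)ᵀ := by
      refine (Matrix.transpose_pow (M.map σ) n).symm.trans (congrArg Matrix.transpose ?_)
      exact (map_pow σ.mapMatrix M n).symm
    rw [Polynomial.map_monomial, aeval_monomial, aeval_monomial, ← Algebra.smul_def,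
      ← Algebra.smul_def, hn]
    ext i j
    simp

theorem card_eq_of_iso {X Y : Pencil F} (φ : X ≅ Y) :
    Fintype.card X.Row = Fintype.card Y.Row ∧ Fintype.card X.Col = Fintype.card Y.Col := by
  have key : ∀ {I J : Type} [Fintype I] [Fintype J] [DecidableEq I] [DecidableEq J]
      (M : Matrix I J F) (N : Matrix J I F), M * N = 1 → N * M = 1 →
      Fintype.card J = Fintype.card I := by
    intro I J _ _ _ _ M N h1 h2
    simpa using (Matrix.toLin'OfInv h2 h1).finrank_eq
  exact ⟨key φ.hom.P φ.inv.P (congrArg Hom.P φ.inv_hom_id) (congrArg Hom.P φ.hom_inv_id),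
    key φ.hom.Q φ.inv.Q (congrArg Hom.Q φ.inv_hom_id) (congrArg Hom.Q φ.hom_inv_id)⟩

end Pencil

theorem IsPrimaryPoly.map {F : Type u} [Field F] {σ : F →+* F} (hσ : ∀ a, σ (σ a) = a) {q : F[X]}
    (hq : IsPrimaryPoly q) : IsPrimaryPoly (q.map σ) := by
  obtain ⟨p, l, hp, hp', hl, rfl⟩ := hq
  let τ : F ≃+* F := RingEquiv.ofRingHom σ σ (RingHom.ext hσ) (RingHom.ext hσ)
  refine ⟨p.map σ, l, hp.map σ, ?_, hl, Polynomial.map_pow _ _⟩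
  exact (MulEquiv.irreducible_iff (Polynomial.mapEquiv τ)).2 hp'

namespace Pencil
variable {F : Type u} [Field F]

theorem nonempty_dual_frob_iso [Finite F] {σ : F →+* F} (hσ : ∀ a, σ (σ a) = a) {q : F[X]}
    (hq : IsPrimaryPoly q) : Nonempty (dual σ (frob q) ≅ frob (q.map σ)) := by
  have hone : ((1 : Mat F q.natDegree).map σ)ᵀ = 1 := by simp
  have hdual : dual σ (frob q) = ofMatrix (((companion F q).map σ)ᵀ) := by
    change (⟨Fin q.natDegree, Fin q.natDegree, ((1 : Mat F q.natDegree).map σ)ᵀ,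
      ((companion F q).map σ)ᵀ⟩ : Pencil F) = _
    rw [hone]
    rfl
  have hindec := dual_isIndec hσ (frob_isIndec hq)
  rw [hdual] at hindec ⊢
  have : Nonempty (Fin q.natDegree) := by
    by_contra h
    rw [not_nonempty_iff] at h
    exact (frob_isIndec hq).ne_zero
      (hom_ext (Matrix.ext fun i => h.elim i) (Matrix.ext fun i => h.elim i))
  obtain ⟨q', hq', ⟨r⟩⟩ := exists_retract_frob (((companion F q).map σ)ᵀ)
  have : IsIso (r.i ≫ r.r) := by rw [r.retract]; infer_instance
  have := (frob_isIndec hq').isIso_of_isIso_comp hindec r.i r.r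
  have φ := asIso r.i
  suffices q' = q.map σ by
    rw [← this]
    exact ⟨φ.symm⟩
  refine Polynomial.eq_of_monic_of_associated hq'.monic (hq.monic.map σ)
    (associated_of_dvd_dvd ?_ ?_)
  · rw [← aeval_companion_eq_zero_iff hq'.monic]
    refine aeval_eq_zero_of_iso φ.symm ?_
    rw [aeval_transpose_map, (aeval_companion_eq_zero_iff hq.monic q).2 dvd_rfl]
    ext
    simp
  · have hmm : (q'.map σ).map σ = q' := by
      rw [Polynomial.map_map, RingHom.ext hσ (f := σ.comp σ) (g := RingHom.id F), Polynomial.map_id]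
    have h1 := aeval_eq_zero_of_iso φ ((aeval_companion_eq_zero_iff hq'.monic q').2 dvd_rfl)
    rw [← hmm, aeval_transpose_map] at h1
    have h2 : aeval (companion F q) (q'.map σ) = 0 := by
      refine Matrix.map_injective σ.injective (Matrix.transpose_injective (h1.trans ?_))
      ext
      simp
    rw [aeval_companion_eq_zero_iff hq.monic] at h2
    have h3 := Polynomial.map_dvd σ h2
    rwa [hmm] at h3

end Pencil
end PencilDuality

section PencilClassification
open CategoryTheory CategoryTheory.Limits
universe u

/-- The labels of the indecomposable pencils: Kronecker blocks, their transposes, and regular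
blocks with infinite or finite eigenvalues. -/
inductive PencilLabel (F : Type u) [Field F] : Type u
  | col (n : ℕ)
  | row (n : ℕ)
  | inf (n : ℕ)
  | fin (q : F[X]) (hq : IsPrimaryPoly q)

namespace PencilLabel

variable {F : Type u} [Field F]

/-- The indecomposable pencil with a given label. -/
def pencil : PencilLabel F → Pencil F
  | col n => Pencil.chain F n (n + 1)
  | row n => Pencil.dual (RingHom.id F) (Pencil.chain F n (n + 1))
  | inf n => Pencil.chain F (n + 1) (n + 1)
  | fin q _ => Pencil.frob q

theorem pencil_isIndec (l : PencilLabel F) : IsIndec l.pencil := by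
  cases l with
  | col n => exact Pencil.chain_isIndec le_rfl (by omega)
  | row n => exact Pencil.dual_isIndec (fun _ => rfl) (Pencil.chain_isIndec le_rfl (by omega))
  | inf n => exact Pencil.chain_isIndec (by omega) le_rfl
  | fin q hq => exact Pencil.frob_isIndec hq

/-- The numbers of rows and columns of an indecomposable pencil. -/
def size : PencilLabel F → ℕ × ℕ
  | col n => (n, n + 1)
  | row n => (n + 1, n)
  | inf n => (n + 1, n + 1)
  | fin q _ => (q.natDegree, q.natDegree)

theorem card_pencil (l : PencilLabel F) :
    (Fintype.card l.pencil.Row, Fintype.card l.pencil.Col) = l.size := by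
  cases l <;> exact Prod.ext (Fintype.card_fin _) (Fintype.card_fin _)

theorem isEmpty_inf_iso_fin (n : ℕ) {q : F[X]} (hq : IsPrimaryPoly q) :
    ¬ Nonempty ((inf n).pencil ≅ (fin q hq).pencil) := by
  rintro ⟨φ⟩
  let P : Matrix (Fin q.natDegree) (Fin (n + 1)) F := φ.hom.P
  let Q : Matrix (Fin q.natDegree) (Fin (n + 1)) F := φ.hom.Q
  let R : Matrix (Fin (n + 1)) (Fin q.natDegree) F := φ.inv.Q
  let A : Mat F (n + 1) := (Pencil.chain F (n + 1) (n + 1)).A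
  have hA : P * A = (1 : Mat F q.natDegree) * Q := φ.hom.hA
  have hRQ : R * Q = 1 := congrArg Pencil.Hom.Q φ.hom_inv_id
  have h0 : A *ᵥ Pi.single 0 1 = 0 := by
    ext i
    simp [A, Pencil.chain]
  have : (Pi.single 0 1 : Fin (n + 1) → F) = 0 := by
    rw [← one_mulVec (Pi.single 0 1 : Fin (n + 1) → F), ← hRQ, ← Matrix.one_mul Q, ← hA,
      ← mulVec_mulVec, ← mulVec_mulVec, h0, mulVec_zero, mulVec_zero]
  simpa using congrFun this 0

theorem eq_of_pencil_iso (l l' : PencilLabel F) (h : Nonempty (l.pencil ≅ l'.pencil)) : l = l' := by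
  have hs : l.size = l'.size := by
    obtain ⟨φ⟩ := h
    rw [← card_pencil, ← card_pencil]
    exact Prod.ext (Pencil.card_eq_of_iso φ).1 (Pencil.card_eq_of_iso φ).2
  have h' : Nonempty (l'.pencil ≅ l.pencil) := h.map Iso.symm
  cases l <;> cases l' <;> simp only [size, Prod.mk.injEq] at hs <;> try omega
  · rw [hs.1]
  · rw [hs.2]
  · rw [show _ = _ from Nat.succ_injective hs.1]
  · exact (isEmpty_inf_iso_fin _ _ h).elim
  · exact (isEmpty_inf_iso_fin _ _ h').elim
  · rename_i q hq q' hq'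
    obtain rfl := Pencil.frob_injective hq.monic hq'.monic h.some
    rfl

theorem exists_retract [Finite F] (X : Pencil F) (hX : 0 < Fintype.card X.Row + Fintype.card X.Col) :
    ∃ l : PencilLabel F, Nonempty (Retract l.pencil X) := by
  by_cases h1 : ∃ v, v ≠ 0 ∧ X.A *ᵥ v = 0
  · obtain ⟨v, hv, hA⟩ := h1
    obtain ⟨n, h | h⟩ := Pencil.exists_retract_of_mulVec_eq_zero X v hv hA
    · exact ⟨col n, h⟩
    · exact ⟨inf n, h⟩
  by_cases h2 : ∃ v, v ≠ 0 ∧ v ᵥ* X.A = 0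
  · obtain ⟨v, hv, hA⟩ := h2
    have hX : Pencil.dual (RingHom.id F) (Pencil.dual (RingHom.id F) X) = X :=
      Pencil.dual_dual (fun _ => rfl) X
    obtain ⟨n, h | h⟩ := Pencil.exists_retract_of_mulVec_eq_zero
      (Pencil.dual (RingHom.id F) X) v hv ((mulVec_transpose X.A v).trans hA)
    · refine ⟨row n, ?_⟩
      have := Pencil.nonempty_dual_retract (RingHom.id F) h.some
      rwa [hX] at this
    · refine ⟨inf n, ?_⟩
      have h' := Pencil.nonempty_dual_retract (RingHom.id F) h.some
      rw [hX] at h'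
      obtain ⟨φ⟩ := Pencil.nonempty_dual_chain_iso (RingHom.id F) (n + 1)
      exact ⟨(Retract.ofIso φ.symm).trans h'.some⟩
  · push Not at h1 h2
    have hsurj : Function.Surjective X.A.mulVec := by
      intro x
      rcases Pencil.exists_mulVec_eq_or_exists_vecMul_eq_zero X.A x with h | ⟨y, hy, hyx⟩
      · exact h
      · refine (h2 y ?_ hy).elim
        rintro rfl
        simp at hyx
    obtain ⟨R, hR⟩ := Matrix.mulVec_surjective_iff_exists_right_inverse.1 hsurj
    have hRA : R * X.A = 1 := by
      refine Matrix.ext_of_mulVec_single fun i => ?_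
      rw [← sub_eq_zero, ← Matrix.sub_mulVec]
      by_contra h
      refine h1 _ h ?_
      rw [mulVec_mulVec, Matrix.mul_sub, ← Matrix.mul_assoc, hR, Matrix.one_mul, Matrix.mul_one,
        sub_self, Matrix.zero_mulVec]
    have hne : Nonempty X.Col := by
      by_contra h
      rw [not_nonempty_iff] at h
      rw [Fintype.card_eq_zero (α := X.Col), add_zero, Fintype.card_pos_iff] at hX
      obtain ⟨i⟩ := hX
      simpa [Matrix.mul_apply] using congrFun (congrFun hR i) i
    obtain ⟨q, hq, ⟨r⟩⟩ := Pencil.exists_retract_frob (R * X.B)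
    obtain ⟨φ⟩ := Pencil.nonempty_iso_of_mul_eq_one (X := X) (Y := Pencil.ofMatrix (R * X.B))
      (P := R) (P' := X.A) (Q := (1 : Matrix X.Col X.Col F))
      (Q' := (1 : Matrix X.Col X.Col F)) hRA hR (Matrix.one_mul _) (Matrix.one_mul _)
      (hRA.trans (Matrix.one_mul _).symm) (Matrix.mul_one _).symm
    exact ⟨fin q hq, ⟨r.trans (Retract.ofIso φ.symm)⟩⟩

/-- Every pencil is a direct sum of indecomposable pencils from the list. -/
theorem exists_iso_listSum [Finite F] (X : Pencil F) :
    ∃ s : List (PencilLabel F), Nonempty (X ≅ listSum pencil s) := by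
  induction hN : Fintype.card X.Row + Fintype.card X.Col using Nat.strong_induction_on
    generalizing X with
  | _ N ih =>
    rcases Nat.eq_zero_or_pos N with rfl | hpos
    · have h1 : IsEmpty X.Row := Fintype.card_eq_zero_iff.1 (by omega)
      have h2 : IsEmpty X.Col := Fintype.card_eq_zero_iff.1 (by omega)
      exact ⟨[], ⟨(Pencil.isZero_of_isEmpty X).iso (isZero_listSum_nil pencil)⟩⟩
    · obtain ⟨l, ⟨r⟩⟩ := exists_retract X (by omega)
      obtain ⟨Y, e, -, -⟩ := exists_biprod_iso_of_retract r.i r.r r.retract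
      obtain ⟨e'⟩ := Pencil.sum_iso_biprod l.pencil Y
      obtain ⟨h1, h2⟩ := Pencil.card_eq_of_iso (e ≪≫ e'.symm)
      have h3 : Fintype.card (l.pencil.sum Y).Row = Fintype.card l.pencil.Row + Fintype.card Y.Row :=
        Fintype.card_sum
      have h4 : Fintype.card (l.pencil.sum Y).Col = Fintype.card l.pencil.Col + Fintype.card Y.Col :=
        Fintype.card_sum
      have h5 : 0 < Fintype.card l.pencil.Row + Fintype.card l.pencil.Col := by
        by_contra h
        have h5 : IsEmpty l.pencil.Row := Fintype.card_eq_zero_iff.1 (by omega)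
        have h6 : IsEmpty l.pencil.Col := Fintype.card_eq_zero_iff.1 (by omega)
        exact l.pencil_isIndec.ne_zero ((IsZero.iff_id_eq_zero _).1 (Pencil.isZero_of_isEmpty _))
      obtain ⟨s, ⟨φ⟩⟩ := ih (Fintype.card Y.Row + Fintype.card Y.Col) (by omega) Y rfl
      exact ⟨l :: s, ⟨e ≪≫ biprod.mapIso (Iso.refl _) φ⟩⟩

theorem perm_of_iso [Finite F] {s t : List (PencilLabel F)}
    (φ : listSum pencil s ≅ listSum pencil t) :
    s.Perm t :=
  perm_of_listSum_iso pencil pencil_isIndec eq_of_pencil_iso s t φ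

/-- The label of the conjugate transpose. -/
def dual {σ : F →+* F} (hσ : ∀ a, σ (σ a) = a) : PencilLabel F → PencilLabel F
  | col n => row n
  | row n => col n
  | inf n => inf n
  | fin q hq => fin (q.map σ) (hq.map hσ)

theorem dual_dual {σ : F →+* F} (hσ : ∀ a, σ (σ a) = a) (l : PencilLabel F) :
    dual hσ (dual hσ l) = l := by
  cases l <;> simp only [dual]
  congr 1
  rw [Polynomial.map_map, RingHom.ext hσ (f := σ.comp σ) (g := RingHom.id F), Polynomial.map_id]

theorem nonempty_dual_pencil_iso [Finite F] {σ : F →+* F} (hσ : ∀ a, σ (σ a) = a) (l : PencilLabel F) :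
    Nonempty (l.pencil.dual σ ≅ (l.dual hσ).pencil) := by
  cases l with
  | col n => exact ⟨eqToIso (Pencil.dual_chain σ _ _)⟩
  | row n =>
    refine ⟨eqToIso ?_⟩
    rw [pencil, ← Pencil.dual_chain σ, Pencil.dual_dual hσ]
    rfl
  | inf n => exact Pencil.nonempty_dual_chain_iso σ _
  | fin q hq => exact Pencil.nonempty_dual_frob_iso hσ hq

theorem _root_.Can.Pencil.transpose_map_fromBlocks {I J K L : Type*} (σ : F →+* F)
    (M : Matrix I J F) (N : Matrix K L F) :
    ((fromBlocks M 0 0 N).map σ)ᵀ = fromBlocks (M.map σ)ᵀ 0 0 (N.map σ)ᵀ := by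
  rw [fromBlocks_map, fromBlocks_transpose]
  congr 1 <;> ext <;> simp

theorem nonempty_dual_listSum_iso [Finite F] {σ : F →+* F} (hσ : ∀ a, σ (σ a) = a)
    (s : List (PencilLabel F)) :
    Nonempty ((listSum pencil s).dual σ ≅ listSum pencil (s.map (dual hσ))) := by
  induction s with
  | nil =>
    have h := (IsZero.iff_id_eq_zero _).1 (isZero_listSum_nil (pencil (F := F)))
    refine ⟨IsZero.iso ((IsZero.iff_id_eq_zero _).2 ?_) (isZero_listSum_nil _)⟩
    rw [← Pencil.dualHom_id, ← Pencil.dualHom_zero, h]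
  | cons l s ih =>
    obtain ⟨φ⟩ := ih
    obtain ⟨e⟩ := Pencil.sum_iso_biprod l.pencil (listSum pencil s)
    obtain ⟨e'⟩ := Pencil.nonempty_dual_iso σ e
    obtain ⟨e''⟩ := Pencil.sum_iso_biprod (l.pencil.dual σ) ((listSum pencil s).dual σ)
    have h : (l.pencil.sum (listSum pencil s)).dual σ =
        (l.pencil.dual σ).sum ((listSum pencil s).dual σ) := by
      simp only [Pencil.dual, Pencil.sum]
      congr 1
      · exact Pencil.transpose_map_fromBlocks σ _ _
      · exact Pencil.transpose_map_fromBlocks σ _ _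
    obtain ⟨ψ⟩ := nonempty_dual_pencil_iso hσ l
    exact ⟨e'.symm ≪≫ eqToIso h ≪≫ e'' ≪≫ biprod.mapIso ψ φ⟩

end PencilLabel

section Orbits
variable {α : Type*} (D : α → α)

open scoped Classical in
/-- The orbit of an element under an involution. -/
def orbit (a : α) : List α := if D a = a then [a] else [a, D a]

theorem mem_orbit_self (a : α) : a ∈ orbit D a := by
  unfold orbit
  split_ifs <;> simp

theorem eq_or_eq_of_mem_orbit {a b : α} (h : a ∈ orbit D b) : a = b ∨ a = D b := by
  unfold orbit at h
  split_ifs at h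
  · exact Or.inl (by simpa using h)
  · simpa using h

variable {D}

theorem orbit_perm (hD : ∀ a, D (D a) = a) {a b : α} (h : a = b ∨ a = D b) :
    (orbit D a).Perm (orbit D b) := by
  rcases h with rfl | rfl
  · exact List.Perm.refl _
  · unfold orbit
    by_cases h : D b = b
    · simp [h]
    · rw [if_neg h, if_neg (fun h' => h (h'.symm.trans (hD b))), hD]
      exact List.Perm.swap _ _ _

/-- A list that is invariant under an involution up to order is a union of orbits. -/
theorem exists_flatMap_orbit_perm (hD : ∀ a, D (D a) = a) (s : List α) (hs : (s.map D).Perm s) :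
    ∃ L : List α, (L.flatMap (orbit D)).Perm s := by
  induction hN : s.length using Nat.strong_induction_on generalizing s with
  | _ N ih =>
    subst hN
    cases s with
    | nil => exact ⟨[], List.Perm.refl _⟩
    | cons a t =>
      by_cases ha : D a = a
      · rw [List.map_cons, ha, List.perm_cons] at hs
        obtain ⟨L, hp⟩ := ih t.length (by simp) t hs rfl
        refine ⟨a :: L, ?_⟩
        rw [List.flatMap_cons, orbit, if_pos ha]
        exact hp.cons a
      · have hmem : D a ∈ t := by
          have : D a ∈ a :: t := hs.subset (by simp)
          exact (List.mem_cons.1 this).resolve_left ha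
        obtain ⟨t', ht'⟩ : ∃ t', t.Perm (D a :: t') := by
          classical
          exact ⟨_, List.perm_cons_erase hmem⟩
        have h1 : (D a :: a :: t'.map D).Perm (D a :: a :: t') := by
          have h2 := (((ht'.cons a).map D).symm.trans hs).trans (ht'.cons a)
          simp only [List.map_cons, hD] at h2
          exact h2.trans (List.Perm.swap _ _ _)
        have hlen := ht'.length_eq
        simp only [List.length_cons] at hlen
        obtain ⟨L, hp⟩ := ih t'.length (by simp; omega) t' h1.cons_inv.cons_inv rfl
        refine ⟨a :: L, ?_⟩
        rw [List.flatMap_cons, orbit, if_neg ha]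
        exact ((hp.cons (D a)).trans ht'.symm).cons a

/-- The orbits in a union of orbits are determined up to order. -/
theorem exists_perm_forall₂_of_flatMap_orbit_perm (hD : ∀ a, D (D a) = a) (l₁ l₂ : List α)
    (h : (l₁.flatMap (orbit D)).Perm (l₂.flatMap (orbit D))) :
    ∃ l, l₁.Perm l ∧ List.Forall₂ (fun a b => a = b ∨ a = D b) l l₂ := by
  induction l₁ generalizing l₂ with
  | nil =>
    cases l₂ with
    | nil => exact ⟨[], List.Perm.refl _, List.Forall₂.nil⟩
    | cons b t =>
      have : b ∈ ([] : List α) :=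
        h.symm.subset (List.mem_flatMap.2 ⟨b, List.mem_cons_self, mem_orbit_self D b⟩)
      simp at this
  | cons a t ih =>
    obtain ⟨b, hb, hab⟩ := List.mem_flatMap.1
      (h.subset (List.mem_flatMap.2 ⟨a, List.mem_cons_self, mem_orbit_self D a⟩))
    replace hab := eq_or_eq_of_mem_orbit D hab
    obtain ⟨t₂, ht₂⟩ : ∃ t₂, l₂.Perm (b :: t₂) := by
      classical
      exact ⟨_, List.perm_cons_erase hb⟩
    have h1 := h.trans (ht₂.flatMap_right _)
    rw [List.flatMap_cons, List.flatMap_cons] at h1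
    obtain ⟨l, hl, hR⟩ := ih t₂
      ((List.perm_append_left_iff _).1 (h1.trans ((orbit_perm hD hab).symm.append_right _)))
    have hcomp : Relation.Comp (List.Forall₂ fun a b => a = b ∨ a = D b) List.Perm (a :: l) l₂ :=
      ⟨b :: t₂, List.Forall₂.cons hab hR, ht₂.symm⟩
    rw [List.forall₂_comp_perm_eq_perm_comp_forall₂] at hcomp
    obtain ⟨l', hl', hR'⟩ := hcomp
    exact ⟨l', (hl.cons a).trans hl', hR'⟩

end Orbits

end PencilClassification

section CanonicalBlocks
open CategoryTheory CategoryTheory.Limits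
universe u

variable {F : Type u} [Field F]

theorem IsPrimaryPoly.map_eq_iff {σ : F →+* F} (hσ : ∀ a, σ (σ a) = a) {p : F[X]} {l : ℕ}
    (hp : p.Monic) (hp' : Irreducible p) (hl : 0 < l) :
    (p ^ l).map σ = p ^ l ↔ ∀ k, σ (p.coeff k) = p.coeff k := by
  have h : (∀ k, σ (p.coeff k) = p.coeff k) ↔ p.map σ = p := by
    simp [Polynomial.ext_iff, Polynomial.coeff_map]
  rw [h, Polynomial.map_pow]
  refine ⟨fun h => ?_, fun h => by rw [h]⟩
  let τ : F ≃+* F := RingEquiv.ofRingHom σ σ (RingHom.ext hσ) (RingHom.ext hσ)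
  have hirr : Irreducible (p.map σ) := (MulEquiv.irreducible_iff (Polynomial.mapEquiv τ)).2 hp'
  have hdvd : p.map σ ∣ p := hirr.prime.dvd_of_dvd_pow (h ▸ dvd_pow_self _ hl.ne')
  exact Polynomial.eq_of_monic_of_associated (hp.map σ) hp (hirr.associated_of_dvd hp' hdvd)

/-- The pencil of a pair of square matrices. -/
def PBlock.pencil (b : PBlock F) : Pencil F := ⟨Fin b.1, Fin b.1, b.2.1, b.2.2⟩

theorem psum_pencil_iso (s : List (PencilLabel F)) (f : PencilLabel F → PBlock F)
    (g : PencilLabel F → List (PencilLabel F))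
    (h : ∀ l, Nonempty ((f l).pencil ≅ listSum PencilLabel.pencil (g l))) :
    Nonempty ((psum (s.map f)).pencil ≅ listSum PencilLabel.pencil (s.flatMap g)) := by
  induction s with
  | nil =>
    have : IsEmpty (psum (List.map f [])).pencil.Row := Fin.isEmpty
    have : IsEmpty (psum (List.map f [])).pencil.Col := Fin.isEmpty
    exact ⟨(Pencil.isZero_of_isEmpty _).iso (isZero_listSum_nil _)⟩
  | cons l s ih =>
    obtain ⟨φ⟩ := ih
    obtain ⟨ψ⟩ := h l
    obtain ⟨e⟩ := Pencil.sum_iso_biprod (f l).pencil (psum (s.map f)).pencil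
    obtain ⟨e'⟩ := Pencil.nonempty_iso_reindex (finSumFinEquiv (m := (f l).1))
      (finSumFinEquiv (m := (f l).1) (n := (psum (s.map f)).1))
      (fromBlocks (f l).2.1 0 0 (psum (s.map f)).2.1)
      (fromBlocks (f l).2.2 0 0 (psum (s.map f)).2.2)
    obtain ⟨e''⟩ := listSum_append PencilLabel.pencil (g l) (s.flatMap g)
    exact ⟨e'.symm ≪≫ e ≪≫ biprod.mapIso ψ φ ≪≫ e''.symm⟩

theorem nonempty_skewSum_pencil_iso {k l : ℕ} (A A' : Matrix (Fin k) (Fin l) F)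
    (B B' : Matrix (Fin l) (Fin k) F) :
    Nonempty (PBlock.pencil ⟨l + k, (skewSum A B, skewSum A' B')⟩ ≅
      (⟨Fin k, Fin l, A, A'⟩ : Pencil F) ⊞ ⟨Fin l, Fin k, B, B'⟩) := by
  obtain ⟨e⟩ := Pencil.nonempty_iso_reindex (finSumFinEquiv (m := l) (n := k))
    (finSumFinEquiv (m := l) (n := k)) (fromBlocks 0 B A 0) (fromBlocks 0 B' A' 0)
  obtain ⟨e'⟩ := Pencil.nonempty_iso_reindex (Equiv.sumComm (Fin l) (Fin k))
    (Equiv.refl _) (fromBlocks 0 B A 0) (fromBlocks 0 B' A' 0)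
  obtain ⟨φ⟩ := Pencil.sum_iso_biprod (⟨Fin k, Fin l, A, A'⟩ : Pencil F) ⟨Fin l, Fin k, B, B'⟩
  have h : ∀ (M : Matrix (Fin k) (Fin l) F) (N : Matrix (Fin l) (Fin k) F),
      reindex (Equiv.sumComm (Fin l) (Fin k)) (Equiv.refl _) (fromBlocks 0 N M 0) =
        fromBlocks M 0 0 N := by
    intro M N
    ext (i | i) (j | j) <;> rfl
  rw [h, h] at e'
  exact ⟨e.symm ≪≫ e' ≪≫ φ⟩

theorem nonempty_FmatGmat_iso (n : ℕ) :
    Nonempty ((⟨Fin n, Fin (n + 1), Fmat F (n + 1), Gmat F (n + 1)⟩ : Pencil F) ≅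
      Pencil.chain F n (n + 1)) := by
  have h : (⟨Fin n, Fin (n + 1), reindex Fin.revPerm Fin.revPerm (Fmat F (n + 1)),
      reindex Fin.revPerm Fin.revPerm (Gmat F (n + 1))⟩ : Pencil F) = Pencil.chain F n (n + 1) := by
    simp only [Pencil.chain]
    congr 1
    · ext i j
      simp only [Fmat, reindex_apply, submatrix_apply, of_apply, Fin.revPerm_symm,
        Fin.revPerm_apply, Fin.val_rev]
      congr 1
      rw [eq_iff_iff]
      have : (i : ℕ) < n := i.2
      omega
    · ext i j
      simp only [Gmat, reindex_apply, submatrix_apply, of_apply, Fin.revPerm_symm,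
        Fin.revPerm_apply, Fin.val_rev]
      congr 1
      rw [eq_iff_iff]
      have : (i : ℕ) < n := i.2
      omega
  exact (Pencil.nonempty_iso_reindex (Fin.revPerm (n := n)) (Fin.revPerm (n := n + 1))
    (Fmat F (n + 1)) (Gmat F (n + 1))).map fun φ => φ ≪≫ eqToIso h

theorem nonempty_Bpair_iso (n : ℕ) :
    Nonempty (PBlock.pencil ⟨n, Bpair F n⟩ ≅ Pencil.chain F n n) := by
  have h : (⟨Fin n, Fin n, reindex (Equiv.refl _) Fin.revPerm (Bpair F n).1,
      reindex (Equiv.refl _) Fin.revPerm (Bpair F n).2⟩ : Pencil F) = Pencil.chain F n n := by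
    simp only [Pencil.chain]
    congr 1
    · ext i j
      simp only [Bpair, reindex_apply, submatrix_apply, of_apply, Fin.revPerm_symm,
        Fin.revPerm_apply, Fin.val_rev, Equiv.refl_symm, Equiv.refl_apply]
      congr 1
      rw [eq_iff_iff]
      omega
    · ext i j
      simp only [Bpair, reindex_apply, submatrix_apply, of_apply, Fin.revPerm_symm,
        Fin.revPerm_apply, Fin.val_rev, Equiv.refl_symm, Equiv.refl_apply]
      congr 1
      rw [eq_iff_iff]
      omega
  exact (Pencil.nonempty_iso_reindex (Equiv.refl (Fin n)) (Fin.revPerm (n := n))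
    (Bpair F n).1 (Bpair F n).2).map fun φ => φ ≪≫ eqToIso h

open scoped Classical in
/-- The canonical pair of Hermitian matrices containing the indecomposable pencil with a given
label. -/
def PencilLabel.block (σ : F →+* F) (N : (q : F[X]) → Mat F q.natDegree) : PencilLabel F → PBlock F
  | .col n => ⟨n + 1 + n, (skewSum (Fmat F (n + 1)) (ctr σ (Fmat F (n + 1))),
      skewSum (Gmat F (n + 1)) (ctr σ (Gmat F (n + 1))))⟩
  | .row n => ⟨n + 1 + n, (skewSum (Fmat F (n + 1)) (ctr σ (Fmat F (n + 1))),
      skewSum (Gmat F (n + 1)) (ctr σ (Gmat F (n + 1))))⟩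
  | .inf n => ⟨n + 1, Bpair F (n + 1)⟩
  | .fin q _ => if q.map σ = q then ⟨q.natDegree, (N q, N q * companion F q)⟩ else pairStar4 σ q

variable {σ : F →+* F} {N : (q : F[X]) → Mat F q.natDegree}

theorem exists_block_eq_iff (hσ : ∀ a, σ (σ a) = a) (b : PBlock F) :
    (∃ l : PencilLabel F, b = l.block σ N) ↔ T4i σ b ∨ T4ii σ b ∨ T4iii σ N b ∨ T4iv b := by
  constructor
  · rintro ⟨l, rfl⟩
    cases l with
    | col n => exact Or.inl ⟨n + 1, n.succ_pos, rfl⟩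
    | row n => exact Or.inl ⟨n + 1, n.succ_pos, rfl⟩
    | inf n => exact Or.inr (Or.inr (Or.inr ⟨n + 1, n.succ_pos, rfl⟩))
    | fin q hq =>
      right
      obtain ⟨p, k, hp, hp', hk, rfl⟩ := hq
      have hiff := IsPrimaryPoly.map_eq_iff hσ hp hp' hk
      by_cases h : (p ^ k).map σ = p ^ k
      · exact Or.inr (Or.inl ⟨p, k, hp, hp', hk, hiff.1 h, if_pos h⟩)
      · exact Or.inl ⟨p, k, hp, hp', hk, fun h' => h (hiff.2 h'), if_neg h⟩
  · rintro (⟨n, hn, rfl⟩ | ⟨p, k, hp, hp', hk, h, rfl⟩ | ⟨p, k, hp, hp', hk, h, rfl⟩ | ⟨n, hn, rfl⟩)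
    · obtain ⟨m, rfl⟩ := Nat.exists_eq_succ_of_ne_zero hn.ne'
      exact ⟨.col m, rfl⟩
    · exact ⟨.fin (p ^ k) ⟨p, k, hp, hp', hk, rfl⟩,
        (if_neg fun h' => h ((IsPrimaryPoly.map_eq_iff hσ hp hp' hk).1 h')).symm⟩
    · exact ⟨.fin (p ^ k) ⟨p, k, hp, hp', hk, rfl⟩,
        (if_pos ((IsPrimaryPoly.map_eq_iff hσ hp hp' hk).2 h)).symm⟩
    · obtain ⟨m, rfl⟩ := Nat.exists_eq_succ_of_ne_zero hn.ne'
      exact ⟨.inf m, rfl⟩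

theorem equiv4_block (hσ : ∀ a, σ (σ a) = a) {l l' : PencilLabel F}
    (h : l = l' ∨ l = l'.dual hσ) : Equiv4 σ (l.block σ N) (l'.block σ N) := by
  rcases h with rfl | h
  · exact Or.inl rfl
  have h' : l' = l.dual hσ := by rw [h, PencilLabel.dual_dual]
  subst h'
  cases l with
  | col n => exact Or.inl rfl
  | row n => exact Or.inl rfl
  | inf n => exact Or.inl rfl
  | fin q hq =>
    by_cases hm : q.map σ = q
    · left
      have hd : PencilLabel.dual hσ (.fin q hq) = .fin q hq := by simp only [PencilLabel.dual, hm]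
      rw [hd]
    · right
      obtain ⟨p, k, hp, hp', hk, rfl⟩ := hq
      refine ⟨p, k, hp, hp', hk, fun h' => hm ((IsPrimaryPoly.map_eq_iff hσ hp hp' hk).2 h'),
        if_neg hm, if_neg fun h' => hm ?_⟩
      exact Polynomial.map_injective σ σ.injective h'

theorem nonempty_block_pencil_iso [Finite F] (hσ : ∀ a, σ (σ a) = a)
    (hN : ∀ q, IsPrimaryPoly q → q.map σ = q → IsUnit (N q).det) (l : PencilLabel F) :
    Nonempty ((l.block σ N).pencil ≅
      listSum PencilLabel.pencil (orbit (PencilLabel.dual hσ) l)) := by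
  have hnil : ∀ l : PencilLabel F, Nonempty (l.pencil ≅ listSum PencilLabel.pencil [l]) := fun l =>
    ⟨(isoBiprodZero (isZero_listSum_nil PencilLabel.pencil))⟩
  have hcol : ∀ n : ℕ, Nonempty ((PencilLabel.block σ N (.col n)).pencil ≅
      listSum PencilLabel.pencil [.col n, .row n]) := by
    intro n
    obtain ⟨e⟩ := nonempty_skewSum_pencil_iso (Fmat F (n + 1)) (Gmat F (n + 1))
      (ctr σ (Fmat F (n + 1))) (ctr σ (Gmat F (n + 1)))
    obtain ⟨φ⟩ := nonempty_FmatGmat_iso (F := F) n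
    obtain ⟨φ'⟩ := Pencil.nonempty_dual_iso σ φ
    obtain ⟨ψ⟩ := PencilLabel.nonempty_dual_pencil_iso hσ (.col n)
    obtain ⟨χ⟩ := hnil (.row n)
    exact ⟨e ≪≫ biprod.mapIso φ (φ' ≪≫ ψ ≪≫ χ)⟩
  cases l with
  | col n =>
    rw [orbit, if_neg (by simp [PencilLabel.dual])]
    exact hcol n
  | row n =>
    rw [orbit, if_neg (by simp [PencilLabel.dual])]
    obtain ⟨e⟩ := hcol n
    obtain ⟨e'⟩ := listSum_perm PencilLabel.pencil (List.Perm.swap (PencilLabel.row (F := F) n)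
      (.col n) [])
    exact ⟨e ≪≫ e'⟩
  | inf n =>
    rw [orbit, if_pos (by rfl)]
    obtain ⟨e⟩ := nonempty_Bpair_iso (F := F) (n + 1)
    obtain ⟨e'⟩ := hnil (.inf n)
    exact ⟨e ≪≫ e'⟩
  | fin q hq =>
    by_cases hm : q.map σ = q
    · rw [orbit, if_pos (by simp only [PencilLabel.dual, hm]), PencilLabel.block, if_pos hm]
      obtain ⟨e'⟩ := hnil (.fin q hq)
      have hu := hN q hq hm
      obtain ⟨e⟩ := Pencil.nonempty_iso_of_mul_eq_one
        (X := PBlock.pencil ⟨q.natDegree, (1, companion F q)⟩)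
        (Y := PBlock.pencil ⟨q.natDegree, (N q, N q * companion F q)⟩)
        (P := N q) (P' := show Mat F q.natDegree from (N q)⁻¹)
        (Q := (1 : Mat F q.natDegree)) (Q' := (1 : Mat F q.natDegree))
        (Matrix.mul_nonsing_inv _ hu) (Matrix.nonsing_inv_mul _ hu) (Matrix.one_mul _)
        (Matrix.one_mul _) rfl (Matrix.mul_one _).symm
      exact ⟨e.symm ≪≫ e'⟩
    · have hd : PencilLabel.dual hσ (.fin q hq) ≠ .fin q hq := by
        simpa only [PencilLabel.dual, ne_eq, PencilLabel.fin.injEq] using hm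
      rw [orbit, if_neg hd, PencilLabel.block, if_neg hm]
      obtain ⟨e⟩ := nonempty_skewSum_pencil_iso (1 : Mat F q.natDegree) (companion F q)
        (1 : Mat F q.natDegree) (ctr σ (companion F q))
      have hone : (⟨Fin q.natDegree, Fin q.natDegree, 1, ctr σ (companion F q)⟩ : Pencil F) =
          Pencil.dual σ (Pencil.frob q) := by
        simp only [Pencil.dual, Pencil.frob, Pencil.ofMatrix]
        congr 1
        simp
      obtain ⟨ψ⟩ := PencilLabel.nonempty_dual_pencil_iso hσ (.fin q hq)
      obtain ⟨χ⟩ := hnil (PencilLabel.dual hσ (.fin q hq))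
      exact ⟨e ≪≫ biprod.mapIso (Iso.refl _) (eqToIso hone ≪≫ ψ ≪≫ χ)⟩

theorem ctr_fromBlocks {k l m n : ℕ} (A : Matrix (Fin k) (Fin m) F) (B : Matrix (Fin k) (Fin n) F)
    (C : Matrix (Fin l) (Fin m) F) (D : Matrix (Fin l) (Fin n) F) :
    ctr σ (reindex finSumFinEquiv finSumFinEquiv (fromBlocks A B C D)) =
      reindex finSumFinEquiv finSumFinEquiv
        (fromBlocks (ctr σ A) (ctr σ C) (ctr σ B) (ctr σ D)) := by
  rw [ctr, reindex_apply, reindex_apply, ← submatrix_map, transpose_submatrix, fromBlocks_map,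
    fromBlocks_transpose]
  rfl

theorem ctr_zero {m n : ℕ} : ctr σ (0 : Matrix (Fin m) (Fin n) F) = 0 := by
  ext
  simp [ctr]

theorem ctr_one {n : ℕ} : ctr σ (1 : Mat F n) = 1 := by
  simp [ctr]

theorem ctr_ctr (hσ : ∀ a, σ (σ a) = a) {m n : ℕ} (A : Matrix (Fin m) (Fin n) F) :
    ctr σ (ctr σ A) = A := by
  ext
  simp [ctr, hσ]

theorem ctr_skewSum (hσ : ∀ a, σ (σ a) = a) {k l : ℕ} (A : Matrix (Fin k) (Fin l) F) :
    ctr σ (skewSum A (ctr σ A)) = skewSum A (ctr σ A) := by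
  rw [skewSum, ctr_fromBlocks, ctr_zero, ctr_zero, ctr_ctr hσ]

theorem block_hermitian (hσ : ∀ a, σ (σ a) = a)
    (hN : ∀ q, IsPrimaryPoly q → q.map σ = q → ctr σ (N q) = N q ∧
      ctr σ (N q * companion F q) = N q * companion F q) (l : PencilLabel F) :
    ctr σ (l.block σ N).2.1 = (l.block σ N).2.1 ∧ ctr σ (l.block σ N).2.2 = (l.block σ N).2.2 := by
  cases l with
  | col n => exact ⟨ctr_skewSum hσ _, ctr_skewSum hσ _⟩
  | row n => exact ⟨ctr_skewSum hσ _, ctr_skewSum hσ _⟩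
  | inf n =>
    have h : ∀ m k : ℕ, ctr σ (of fun i j : Fin m => if (i : ℕ) + j + k = m then (1 : F) else 0) =
        of fun i j : Fin m => if (i : ℕ) + j + k = m then (1 : F) else 0 := by
      intro m k
      ext i j
      simp [ctr, apply_ite σ, add_comm (i : ℕ)]
    exact ⟨h _ _, h _ _⟩
  | fin q hq =>
    by_cases hm : q.map σ = q
    · rw [PencilLabel.block, if_pos hm]
      exact hN q hq hm
    · rw [PencilLabel.block, if_neg hm]
      refine ⟨?_, ctr_skewSum hσ _⟩
      have := ctr_skewSum hσ (1 : Mat F q.natDegree)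
      rwa [ctr_one] at this

theorem psum_hermitian (L : List (PBlock F))
    (hL : ∀ b ∈ L, ctr σ b.2.1 = b.2.1 ∧ ctr σ b.2.2 = b.2.2) :
    ctr σ (psum L).2.1 = (psum L).2.1 ∧ ctr σ (psum L).2.2 = (psum L).2.2 := by
  induction L with
  | nil => exact ⟨Matrix.ext fun i => i.elim0, Matrix.ext fun i => i.elim0⟩
  | cons b L ih =>
    obtain ⟨⟨h1, h2⟩, hL⟩ := List.forall_mem_cons.1 hL
    obtain ⟨h3, h4⟩ := ih hL
    constructor
    · refine (ctr_fromBlocks _ _ _ _).trans ?_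
      rw [h1, h3, ctr_zero, ctr_zero]
      rfl
    · refine (ctr_fromBlocks _ _ _ _).trans ?_
      rw [h2, h4, ctr_zero, ctr_zero]
      rfl

end CanonicalBlocks

section NormEquation

theorem exists_sq_sub_mul_sq_of_field {K : Type*} [Field K] [Finite K] (h2 : ringChar K ≠ 2)
    {d : K} (hd : d ≠ 0) (x : K) : ∃ u v : K, u ^ 2 - d * v ^ 2 = x := by
  have := Fintype.ofFinite K
  have h1 : degree (X ^ 2 : K[X]) = 2 := degree_X_pow 2
  have h3 : degree (C (-d) * X ^ 2 + C 0 * X + C (-x)) = 2 := degree_quadratic (neg_ne_zero.2 hd)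
  obtain ⟨u, v, huv⟩ := FiniteField.exists_root_sum_quadratic h1 h3
    (FiniteField.odd_card_of_char_ne_two h2)
  refine ⟨u, v, ?_⟩
  simp only [eval_add, eval_mul, eval_pow, eval_X, eval_C] at huv
  linear_combination huv

theorem exists_sq_sub_mul_sq_of_isReduced {R : Type*} [CommRing R] [Finite R] [IsReduced R]
    (h2 : IsUnit (2 : R)) {d : R} (hd : IsUnit d) (x : R) : ∃ u v : R, u ^ 2 - d * v ^ 2 = x := by
  let e := IsArtinianRing.equivPi R
  have key : ∀ I : MaximalSpectrum R, ∃ u v : R ⧸ I.asIdeal, u ^ 2 - e d I * v ^ 2 = e x I := by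
    intro I
    let _ : Field (R ⧸ I.asIdeal) := Ideal.Quotient.field I.asIdeal
    have : Finite (R ⧸ I.asIdeal) := Finite.of_surjective _ Ideal.Quotient.mk_surjective
    refine exists_sq_sub_mul_sq_of_field ?_ ((hd.map e).map (Pi.evalRingHom _ I)).ne_zero _
    intro h
    have h0 := ringChar.Nat.cast_ringChar (R := R ⧸ I.asIdeal)
    have := (h2.map (Ideal.Quotient.mk I.asIdeal)).ne_zero
    rw [map_ofNat] at this
    rw [h] at h0
    exact this h0
  choose u v huv using key
  refine ⟨e.symm u, e.symm v, e.injective ?_⟩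
  rw [map_sub, map_pow, map_mul, map_pow, e.apply_symm_apply, e.apply_symm_apply]
  exact funext huv

theorem exists_sq_sub_mul_sq {R : Type*} [CommRing R] [Finite R] (p : ℕ) [Fact p.Prime] [CharP R p]
    (hp : p ≠ 2) {d : R} (hd : IsUnit d) {x : R} (hx : IsUnit x) :
    ∃ u v : R, u ^ 2 - d * v ^ 2 = x := by
  have hodd : Odd p := (Fact.out : p.Prime).odd_of_ne_two hp
  have h2 : IsUnit (2 : R) := by
    have := (Nat.isCoprime_iff_coprime.2 (Nat.coprime_two_left.2 hodd)).map (Int.castRingHom R)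
    obtain ⟨a, b, hab⟩ := this
    refine IsUnit.of_mul_eq_one a ?_
    simpa [mul_comm] using hab
  let π := Ideal.Quotient.mk (nilradical R)
  have : IsReduced (R ⧸ nilradical R) :=
    (Ideal.isRadical_iff_quotient_reduced _).1 (Ideal.radical_isRadical _)
  have : Finite (R ⧸ nilradical R) := Finite.of_surjective _ Ideal.Quotient.mk_surjective
  obtain ⟨u', v', h⟩ := exists_sq_sub_mul_sq_of_isReduced
    (R := R ⧸ nilradical R) (map_ofNat π 2 ▸ h2.map π) (hd.map π) (π x)
  obtain ⟨u, rfl⟩ := Ideal.Quotient.mk_surjective u'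
  obtain ⟨v, rfl⟩ := Ideal.Quotient.mk_surjective v'
  have hnil : IsNilpotent (u ^ 2 - d * v ^ 2 - x) := by
    rw [← mem_nilradical, ← Ideal.Quotient.eq, ← h]
    simp [π]
  obtain ⟨y, hy⟩ := hx.exists_right_inv
  obtain ⟨k, hk⟩ : IsNilpotent (y * (u ^ 2 - d * v ^ 2 - x)) :=
    (Commute.all _ _).isNilpotent_mul_left hnil
  have hpow : (1 + y * (u ^ 2 - d * v ^ 2 - x)) ^ p ^ k = 1 := by
    rw [add_pow_char_pow, one_pow, pow_eq_zero_of_le (Nat.lt_pow_self (Fact.out : p.Prime).one_lt).le hk,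
      add_zero]
  have hw : 1 + y * (u ^ 2 - d * v ^ 2 - x) = y * (u ^ 2 - d * v ^ 2) := by
    linear_combination -hy
  rw [hw] at hpow
  obtain ⟨m, hm⟩ := hodd.pow (n := k)
  refine ⟨u * (y * (u ^ 2 - d * v ^ 2)) ^ m, v * (y * (u ^ 2 - d * v ^ 2)) ^ m, ?_⟩
  have h3 : (u ^ 2 - d * v ^ 2) * (y * (u ^ 2 - d * v ^ 2)) ^ (2 * m) = x := by
    rw [hm, pow_succ] at hpow
    linear_combination (x) * hpow - (u ^ 2 - d * v ^ 2) * (y * (u ^ 2 - d * v ^ 2)) ^ (2 * m) * hy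
  rw [← h3]
  ring

end NormEquation

section StarCongruence
open CategoryTheory
universe u
variable {F : Type u} [Field F] {σ : F →+* F}

theorem ctr_mul {k l m : ℕ} (A : Matrix (Fin k) (Fin l) F) (B : Matrix (Fin l) (Fin m) F) :
    ctr σ (A * B) = ctr σ B * ctr σ A := by
  rw [ctr, Matrix.map_mul, Matrix.transpose_mul]
  rfl

theorem ctr_add {m n : ℕ} (A B : Matrix (Fin m) (Fin n) F) : ctr σ (A + B) = ctr σ A + ctr σ B := by
  ext
  simp [ctr]

theorem ctr_neg {m n : ℕ} (A : Matrix (Fin m) (Fin n) F) : ctr σ (-A) = -ctr σ A := by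
  ext
  simp [ctr]

theorem ctr_smul {m n : ℕ} (a : F) (A : Matrix (Fin m) (Fin n) F) :
    ctr σ (a • A) = σ a • ctr σ A := by
  ext
  simp [ctr]

theorem isUnit_ctr {n : ℕ} {A : Mat F n} (hA : IsUnit A) : IsUnit (ctr σ A) := by
  obtain ⟨B, h1⟩ := hA.exists_right_inv
  refine IsUnit.of_mul_eq_one_right (ctr σ B) ?_
  rw [← ctr_mul, h1, ctr_one]

/-- An element that is antisymmetric under the involution. -/
theorem exists_map_eq_neg (hσ : ∀ a, σ (σ a) = a) (hid : σ ≠ RingHom.id F) :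
    ∃ δ : F, δ ≠ 0 ∧ σ δ = -δ := by
  obtain ⟨a, ha⟩ : ∃ a, σ a ≠ a := by
    by_contra! h
    exact hid (RingHom.ext h)
  exact ⟨a - σ a, sub_ne_zero.2 ha.symm, by rw [map_sub, hσ, neg_sub]⟩

/-- A unit that is selfadjoint for two Hermitian matrices is of the form `k* k` for the adjunction
with respect to these matrices. -/
theorem exists_adjoint_mul_eq [Finite F] (hchar : (2 : F) ≠ 0) (hσ : ∀ a, σ (σ a) = a)
    (hid : σ ≠ RingHom.id F) {n : ℕ} (hn : n ≠ 0) {A B g : Mat F n} (hg : IsUnit g)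
    (hA : A * g = ctr σ g * A) (hB : B * g = ctr σ g * B) :
    ∃ k k' : Mat F n, k' * k = g ∧ k * g = g * k ∧
      ctr σ k * A = A * k' ∧ ctr σ k * B = B * k' := by
  obtain ⟨δ, hδ0, hδ⟩ := exists_map_eq_neg hσ hid
  let D : Mat F n := algebraMap F _ (δ ^ 2)
  have hDc : ∀ M : Mat F n, D * M = M * D := fun M => Algebra.commutes _ _
  have hctrD : ctr σ D = D := by
    simp only [D, Algebra.algebraMap_eq_smul_one]
    rw [ctr_smul, ctr_one, map_pow, hδ, neg_sq]
  have hcomm : ∀ x ∈ ({g, D} : Set (Mat F n)), ∀ y ∈ ({g, D} : Set (Mat F n)), x * y = y * x := by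
    rintro x (rfl | rfl) y (rfl | rfl)
    · rfl
    · exact (hDc _).symm
    · exact hDc _
    · rfl
  let R := Subring.closure ({g, D} : Set (Mat F n))
  have : IsMulCommutative R := Subring.isMulCommutative_closure hcomm
  let _ : CommRing R := { R.toRing with mul_comm := fun x y => mul_comm' x y }
  have : Nonempty (Fin n) := ⟨⟨0, Nat.pos_of_ne_zero hn⟩⟩
  obtain ⟨p, hp⟩ := CharP.exists F
  have : Fact p.Prime := ⟨CharP.char_is_prime F p⟩
  have : CharP (Mat F n) p := charP_of_injective_algebraMap (algebraMap F (Mat F n)).injective p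
  have : CharP R p := R.subtype.charP Subtype.val_injective p
  have hp2 : p ≠ 2 := by
    rintro rfl
    exact hchar (CharP.cast_eq_zero F 2)
  have : Finite R := inferInstance
  have hunit : ∀ x : R, IsUnit (x : Mat F n) → IsUnit x := by
    intro x hx
    obtain ⟨m, hm, h⟩ := (isOfFinOrder_of_finite hx.unit).exists_pow_eq_one
    refine IsUnit.of_pow_eq_one (n := m) (Subtype.ext ?_) hm.ne'
    simpa using congrArg Units.val h
  have hDu : IsUnit D := (isUnit_iff_ne_zero.2 (pow_ne_zero 2 hδ0)).map (algebraMap F (Mat F n))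
  obtain ⟨u, v, huv⟩ := exists_sq_sub_mul_sq (R := R) p hp2
    (hunit ⟨D, Subring.subset_closure (by simp)⟩ hDu)
    (hunit ⟨g, Subring.subset_closure (by simp)⟩ hg)
  have huv' : (u : Mat F n) * u - D * (v * v) = g := by
    have := congrArg Subtype.val huv
    rw [pow_two, pow_two] at this
    exact this
  have hcom : ∀ x y : R, (x : Mat F n) * y = y * x := fun x y => congrArg Subtype.val (mul_comm x y)
  have hadj : ∀ M : Mat F n, M * g = ctr σ g * M → ∀ x : R, ctr σ (x : Mat F n) * M = M * x := by
    rintro M hM ⟨x, hx⟩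
    change ctr σ x * M = M * x
    induction hx using Subring.closure_induction with
    | mem x hx =>
      rcases hx with rfl | rfl
      · exact hM.symm
      · rw [hctrD, hDc]
    | zero => rw [ctr_zero, Matrix.zero_mul, Matrix.mul_zero]
    | one => rw [ctr_one, Matrix.one_mul, Matrix.mul_one]
    | add x y _ _ hx hy => rw [ctr_add, Matrix.add_mul, hx, hy, Matrix.mul_add]
    | neg x _ hx => rw [ctr_neg, Matrix.neg_mul, hx, Matrix.mul_neg]
    | mul x y hx' hy' hx hy =>
      rw [ctr_mul, Matrix.mul_assoc, hx, ← Matrix.mul_assoc, hy, Matrix.mul_assoc,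
        hcom ⟨y, hy'⟩ ⟨x, hx'⟩]
  have hgR : g ∈ R := Subring.subset_closure (by simp)
  have hu : ↑u * g = g * u := hcom u ⟨g, hgR⟩
  have hv : ↑v * g = g * v := hcom v ⟨g, hgR⟩
  have hadj' : ∀ M : Mat F n, M * g = ctr σ g * M →
      ctr σ ((u : Mat F n) + δ • (v : Mat F n)) * M = M * ((u : Mat F n) - δ • (v : Mat F n)) := by
    intro M hM
    rw [ctr_add, ctr_smul, Matrix.add_mul, Matrix.smul_mul, hadj M hM, hadj M hM, hδ, Matrix.mul_sub,
      Matrix.mul_smul, neg_smul, sub_eq_add_neg]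
  refine ⟨u + δ • (v : Mat F n), u - δ • (v : Mat F n), ?_, ?_, hadj' A hA, hadj' B hB⟩
  · rw [← huv']
    simp only [D, ← Algebra.smul_def, sub_mul, mul_add, Matrix.smul_mul, Matrix.mul_smul, smul_smul,
      hcom v u, pow_two]
    abel
  · rw [Matrix.add_mul, Matrix.mul_add, Matrix.smul_mul, Matrix.mul_smul, hu, hv]

theorem starCongruent_of_equivalent [Finite F] (hchar : (2 : F) ≠ 0) (hσ : ∀ a, σ (σ a) = a)
    (hid : σ ≠ RingHom.id F) {n : ℕ} {A₁ B₁ A₂ B₂ P Q : Mat F n} (hA₁ : ctr σ A₁ = A₁)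
    (hB₁ : ctr σ B₁ = B₁) (hA₂ : ctr σ A₂ = A₂) (hB₂ : ctr σ B₂ = B₂) (hP : IsUnit P)
    (hQ : IsUnit Q) (hA : P * A₁ = A₂ * Q) (hB : P * B₁ = B₂ * Q) :
    ∃ S : Mat F n, IsUnit S.det ∧ ctr σ S * A₁ * S = A₂ ∧ ctr σ S * B₁ * S = B₂ := by
  rcases Nat.eq_zero_or_pos n with rfl | hn
  · exact ⟨1, by simp, Matrix.ext fun i => i.elim0, Matrix.ext fun i => i.elim0⟩
  have hf : IsUnit (Q * ctr σ P) := hQ.mul (isUnit_ctr hP)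
  obtain ⟨g, hfg⟩ := hf.exists_right_inv
  have hgf : g * (Q * ctr σ P) = 1 := mul_eq_one_comm.1 hfg
  have hg : IsUnit g := IsUnit.of_mul_eq_one _ hgf
  have hself : ∀ M N : Mat F n, ctr σ M = M → ctr σ N = N → P * M = N * Q →
      N * g = ctr σ g * N := by
    intro M N hM hN h
    have h1 : N * (Q * ctr σ P) = P * M * ctr σ P := by rw [← Matrix.mul_assoc, ← h]
    have h2 : ctr σ (Q * ctr σ P) * N = N * (Q * ctr σ P) := by
      have := congrArg (ctr σ) h1
      rw [ctr_mul, hN, ctr_mul (P * M), ctr_mul P, hM, ctr_ctr hσ, ← Matrix.mul_assoc, ← h1] at this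
      exact this
    have h3 : ctr σ g * ctr σ (Q * ctr σ P) = 1 := by rw [← ctr_mul, hfg, ctr_one]
    calc N * g = ctr σ g * ctr σ (Q * ctr σ P) * (N * g) := by rw [h3, Matrix.one_mul]
      _ = ctr σ g * (ctr σ (Q * ctr σ P) * N) * g := by simp only [Matrix.mul_assoc]
      _ = ctr σ g * N * ((Q * ctr σ P) * g) := by rw [h2]; simp only [Matrix.mul_assoc]
      _ = ctr σ g * N := by rw [hfg, Matrix.mul_one]
  obtain ⟨k, k', hk, hkg, hkA, hkB⟩ := exists_adjoint_mul_eq hchar hσ hid hn.ne' hg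
    (hself A₁ A₂ hA₁ hA₂ hA) (hself B₁ B₂ hB₁ hB₂ hB)
  have hku : IsUnit k := by
    refine isUnit_of_mul_isUnit_right (x := k') ?_
    rwa [hk]
  have hfin : ∀ M N : Mat F n, P * M = N * Q → ctr σ k * N = N * k' →
      ctr σ (ctr σ P * k) * M * (ctr σ P * k) = N := by
    intro M N h h'
    have h1 : k * (Q * ctr σ P) = Q * ctr σ P * k := by
      calc k * (Q * ctr σ P) = (Q * ctr σ P) * (g * k) * (Q * ctr σ P) := by
            rw [← Matrix.mul_assoc (Q * ctr σ P) g, hfg, Matrix.one_mul]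
        _ = (Q * ctr σ P) * k * (g * (Q * ctr σ P)) := by
            rw [← hkg]; simp only [Matrix.mul_assoc]
        _ = _ := by rw [hgf, Matrix.mul_one]
    calc ctr σ (ctr σ P * k) * M * (ctr σ P * k)
        = ctr σ k * (P * M) * (ctr σ P * k) := by
          rw [ctr_mul, ctr_ctr hσ]; simp only [Matrix.mul_assoc]
      _ = ctr σ k * N * (Q * ctr σ P * k) := by rw [h]; simp only [Matrix.mul_assoc]
      _ = N * (k' * k * (Q * ctr σ P)) := by rw [h', ← h1]; simp only [Matrix.mul_assoc]
      _ = N := by rw [hk, hgf, Matrix.mul_one]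
  refine ⟨ctr σ P * k, (Matrix.isUnit_iff_isUnit_det _).1 ((isUnit_ctr hP).mul hku),
    hfin _ _ hA hkA, hfin _ _ hB hkB⟩

theorem pStarCong_of_pencil_iso [Finite F] (hchar : (2 : F) ≠ 0) (hσ : ∀ a, σ (σ a) = a)
    (hid : σ ≠ RingHom.id F) {b c : PBlock F}
    (hb : ctr σ b.2.1 = b.2.1 ∧ ctr σ b.2.2 = b.2.2)
    (hc : ctr σ c.2.1 = c.2.1 ∧ ctr σ c.2.2 = c.2.2) (φ : b.pencil ≅ c.pencil) :
    PStarCong σ b c := by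
  have hcard := (Pencil.card_eq_of_iso φ).1
  obtain ⟨m, A₁, B₁⟩ := b
  obtain ⟨n, A₂, B₂⟩ := c
  obtain rfl : m = n := (Fintype.card_fin m).symm.trans (hcard.trans (Fintype.card_fin n))
  let P : Mat F m := φ.hom.P
  let P' : Mat F m := φ.inv.P
  let Q : Mat F m := φ.hom.Q
  let Q' : Mat F m := φ.inv.Q
  have hP : P * P' = 1 := congrArg Pencil.Hom.P φ.inv_hom_id
  have hQ : Q * Q' = 1 := congrArg Pencil.Hom.Q φ.inv_hom_id
  exact ⟨rfl, starCongruent_of_equivalent hchar hσ hid hb.1 hb.2 hc.1 hc.2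
    (IsUnit.of_mul_eq_one _ hP) (IsUnit.of_mul_eq_one _ hQ) φ.hom.hA φ.hom.hB⟩

theorem nonempty_pencil_iso_of_pStarCong {b c : PBlock F} (h : PStarCong σ b c) :
    Nonempty (b.pencil ≅ c.pencil) := by
  obtain ⟨m, A₁, B₁⟩ := b
  obtain ⟨n, A₂, B₂⟩ := c
  obtain ⟨rfl : m = n, S, hS, hA, hB⟩ := h
  change ctr σ S * A₁ * S = A₂ at hA
  change ctr σ S * B₁ * S = B₂ at hB
  obtain ⟨T, hT⟩ := ((Matrix.isUnit_iff_isUnit_det _).2 hS).exists_right_inv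
  have hctr : ctr σ T * ctr σ S = 1 := by rw [← ctr_mul, hT, ctr_one]
  refine Pencil.nonempty_iso_of_mul_eq_one (X := PBlock.pencil ⟨m, (A₁, B₁)⟩)
    (Y := PBlock.pencil ⟨m, (A₂, B₂)⟩) (P := ctr σ S) (P' := ctr σ T) (Q := T) (Q' := S)
    (mul_eq_one_comm.1 hctr) hctr (mul_eq_one_comm.1 hT) hT ?_ ?_
  · change ctr σ S * A₁ = A₂ * T
    rw [← hA, Matrix.mul_assoc _ S T, hT, Matrix.mul_one]
  · change ctr σ S * B₁ = B₂ * T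
    rw [← hB, Matrix.mul_assoc _ S T, hT, Matrix.mul_one]

end StarCongruence

section CanonicalForm
open CategoryTheory
universe u
variable {F : Type u} [Field F] {σ : F →+* F} {N : (q : F[X]) → Mat F q.natDegree}

theorem exists_pStarCong_psum_block [Finite F] (hchar : (2 : F) ≠ 0) (hσ : ∀ a, σ (σ a) = a)
    (hid : σ ≠ RingHom.id F)
    (hdet : ∀ q, IsPrimaryPoly q → q.map σ = q → IsUnit (N q).det)
    (hherm : ∀ q, IsPrimaryPoly q → q.map σ = q → ctr σ (N q) = N q ∧
      ctr σ (N q * companion F q) = N q * companion F q)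
    {b : PBlock F} (hb : ctr σ b.2.1 = b.2.1 ∧ ctr σ b.2.2 = b.2.2) :
    ∃ l : List (PencilLabel F), PStarCong σ b (psum (l.map (PencilLabel.block σ N))) := by
  obtain ⟨s, ⟨φ⟩⟩ := PencilLabel.exists_iso_listSum b.pencil
  have hself : b.pencil.dual σ = b.pencil := by
    obtain ⟨n, A, B⟩ := b
    exact congrArg₂ (fun A B => (⟨Fin n, Fin n, A, B⟩ : Pencil F)) hb.1 hb.2
  obtain ⟨ψ⟩ := Pencil.nonempty_dual_iso (σ := σ) φ
  rw [hself] at ψ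
  obtain ⟨χ⟩ := PencilLabel.nonempty_dual_listSum_iso hσ s
  obtain ⟨l, hl⟩ := exists_flatMap_orbit_perm (PencilLabel.dual_dual hσ) s
    (PencilLabel.perm_of_iso (χ.symm ≪≫ ψ.symm ≪≫ φ))
  obtain ⟨θ⟩ := psum_pencil_iso l _ _ (nonempty_block_pencil_iso hσ hdet)
  obtain ⟨ω⟩ := listSum_perm PencilLabel.pencil hl
  refine ⟨l, pStarCong_of_pencil_iso hchar hσ hid hb (psum_hermitian _ fun c hc => ?_)
    (φ ≪≫ ω.symm ≪≫ θ.symm)⟩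
  obtain ⟨i, -, rfl⟩ := List.mem_map.1 hc
  exact block_hermitian hσ hherm i

theorem exists_perm_forall₂_equiv4 [Finite F] (hσ : ∀ a, σ (σ a) = a)
    (hdet : ∀ q, IsPrimaryPoly q → q.map σ = q → IsUnit (N q).det)
    {b : PBlock F} {l₁ l₂ : List (PencilLabel F)}
    (h₁ : PStarCong σ b (psum (l₁.map (PencilLabel.block σ N))))
    (h₂ : PStarCong σ b (psum (l₂.map (PencilLabel.block σ N)))) :
    ∃ L, (l₁.map (PencilLabel.block σ N)).Perm L ∧
      List.Forall₂ (Equiv4 σ) L (l₂.map (PencilLabel.block σ N)) := by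
  obtain ⟨φ₁⟩ := nonempty_pencil_iso_of_pStarCong h₁
  obtain ⟨φ₂⟩ := nonempty_pencil_iso_of_pStarCong h₂
  obtain ⟨θ₁⟩ := psum_pencil_iso l₁ _ _ (nonempty_block_pencil_iso hσ hdet)
  obtain ⟨θ₂⟩ := psum_pencil_iso l₂ _ _ (nonempty_block_pencil_iso hσ hdet)
  obtain ⟨l, hl, h⟩ := exists_perm_forall₂_of_flatMap_orbit_perm (PencilLabel.dual_dual hσ) l₁ l₂
    (PencilLabel.perm_of_iso (θ₁.symm ≪≫ φ₁.symm ≪≫ φ₂ ≪≫ θ₂))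
  refine ⟨l.map (PencilLabel.block σ N), hl.map _, ?_⟩
  rw [List.forall₂_map_left_iff, List.forall₂_map_right_iff]
  exact h.imp fun _ _ => equiv4_block hσ

end CanonicalForm

theorem stmt4 (F : Type*) [Field F] [Fintype F] (hchar : (2 : F) ≠ 0)
    (σ : F →+* F) (hσinv : ∀ a, σ (σ a) = a) (hσ : σ ≠ RingHom.id F)
    (Phi1 : (q : Polynomial F) → Mat F q.natDegree)
    (hPhi1 : ∀ (pp : Polynomial F) (l : ℕ), pp.Monic → Irreducible pp → 0 < l →
      (∀ k : ℕ, σ (pp.coeff k) = pp.coeff k) →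
      IsUnit (Phi1 (pp ^ l)).det ∧ ctr σ (Phi1 (pp ^ l)) = Phi1 (pp ^ l) ∧
        ctr σ (Phi1 (pp ^ l) * companion F (pp ^ l)) = Phi1 (pp ^ l) * companion F (pp ^ l))
    (n : ℕ) (A B : Mat F n) (hA : ctr σ A = A) (hB : ctr σ B = B) :
    (∃ L : List (PBlock F), (∀ b ∈ L, T4i σ b ∨ T4ii σ b ∨ T4iii σ Phi1 b ∨ T4iv b) ∧
      PStarCong σ ⟨n, (A, B)⟩ (psum L)) ∧
    (∀ L₁ L₂ : List (PBlock F),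
      (∀ b ∈ L₁, T4i σ b ∨ T4ii σ b ∨ T4iii σ Phi1 b ∨ T4iv b) →
      (∀ b ∈ L₂, T4i σ b ∨ T4ii σ b ∨ T4iii σ Phi1 b ∨ T4iv b) →
      PStarCong σ ⟨n, (A, B)⟩ (psum L₁) → PStarCong σ ⟨n, (A, B)⟩ (psum L₂) →
      ∃ L₂' : List (PBlock F), L₁.Perm L₂' ∧ List.Forall₂ (Equiv4 σ) L₂' L₂) := by
  have hN : ∀ q, IsPrimaryPoly q → q.map σ = q → IsUnit (Phi1 q).det ∧ ctr σ (Phi1 q) = Phi1 q ∧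
      ctr σ (Phi1 q * companion F q) = Phi1 q * companion F q := by
    rintro _ ⟨p, k, hp, hp', hk, rfl⟩ h
    exact hPhi1 p k hp hp' hk ((IsPrimaryPoly.map_eq_iff hσinv hp hp' hk).1 h)
  have hdet := fun q hq h => (hN q hq h).1
  have hlabel : ∀ L : List (PBlock F), (∀ b ∈ L, T4i σ b ∨ T4ii σ b ∨ T4iii σ Phi1 b ∨ T4iv b) →
      ∃ l : List (PencilLabel F), l.map (PencilLabel.block σ Phi1) = L := by
    intro L hL
    refine Set.mem_range.1 ?_
    rw [Set.range_list_map]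
    exact fun b hb => ((exists_block_eq_iff hσinv b).2 (hL b hb)).imp fun _ h => h.symm
  refine ⟨?_, fun L₁ L₂ hL₁ hL₂ h₁ h₂ => ?_⟩
  · obtain ⟨l, hl⟩ := exists_pStarCong_psum_block hchar hσinv hσ hdet (fun q hq h => (hN q hq h).2)
      (b := ⟨n, (A, B)⟩) ⟨hA, hB⟩
    refine ⟨_, fun b hb => (exists_block_eq_iff hσinv b).1 ?_, hl⟩
    obtain ⟨i, -, rfl⟩ := List.mem_map.1 hb
    exact ⟨i, rfl⟩
  · obtain ⟨l₁, rfl⟩ := hlabel L₁ hL₁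
    obtain ⟨l₂, rfl⟩ := hlabel L₂ hL₂
    exact exists_perm_forall₂_equiv4 hσinv hdet h₁ h₂

end Stmt4
end
end Can
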